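/- Let V ∈ M_{r×t}(ℤ) be translation-invariant of rank r and complexity one. There is a constant C = C(r,t,V) such that: for every subset A ⊆ [−N,N] of density α = |A|/(2N+1), the number of solutions y ∈ A^t to Vy = 0 is at least exp(−C α^{−24t}) · N^{t−r}. -/

import Mathlib

/-- The rational row space of an integer matrix. -/
def rowSpanQ (r t : ℕ) (V : Matrix (Fin r) (Fin t) ℤ) : Submodule ℚ (Fin t → ℚ) :=
  Submodule.span ℚ (Set.range fun k => fun j => (V k j : ℚ))

/-- `V` has complexity (at most) one: for each column index `i`, the remaining indices
split into two nonempty classes `X₁ ⊔ X₂ = [t] \ {i}` such that the affine subspace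
`e_i + span{e_j : j ∈ X_k}` avoids the row space of `V` for `k = 1, 2` (the matrix
complexity criterion). -/
def MatrixComplexityOne (r t : ℕ) (V : Matrix (Fin r) (Fin t) ℤ) : Prop :=
  ∀ i : Fin t, ∃ X₁ X₂ : Finset (Fin t),
    X₁.Nonempty ∧ X₂.Nonempty ∧ Disjoint X₁ X₂ ∧ X₁ ∪ X₂ = Finset.univ.erase i ∧
    (¬ ∃ y ∈ rowSpanQ r t V, y i = 1 ∧ ∀ j, j ≠ i → j ∉ X₁ → y j = 0) ∧
    (¬ ∃ y ∈ rowSpanQ r t V, y i = 1 ∧ ∀ j, j ≠ i → j ∉ X₂ → y j = 0)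

section ComplexityOne

open Finset
open scoped BigOperators Classical

/-- A symmetric subadditive function `n ≤ 2` whose balls have the doubling property of Bohr sets
of rank `d`, in the form of a covering condition that is stable under maxima. -/
structure IsBohrNorm {H : Type*} [AddCommGroup H] (n : H → ℝ) (d : ℕ) : Prop where
  zero : n 0 = 0
  nonneg : ∀ x, 0 ≤ n x
  neg : ∀ x, n (-x) = n x
  add_le : ∀ x y, n (x + y) ≤ n x + n y
  le_two : ∀ x, n x ≤ 2
  cover : ∀ ρ : ℝ, 0 < ρ → ∃ c : H → Fin (2 ^ (7 * d)), ∀ x y,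
    n x ≤ 2 * ρ → n y ≤ 2 * ρ → c x = c y → n (x - y) ≤ ρ

/-- The ball of radius `ρ` around `0`. -/
noncomputable def bohrBall {H : Type*} [Fintype H] (n : H → ℝ) (ρ : ℝ) : Finset H :=
  univ.filter fun x => n x ≤ ρ

@[simp] lemma mem_bohrBall {H : Type*} [Fintype H] {n : H → ℝ} {ρ : ℝ} {x : H} :
    x ∈ bohrBall n ρ ↔ n x ≤ ρ := by
  simp [bohrBall]

lemma bohrBall_mono {H : Type*} [Fintype H] (n : H → ℝ) {ρ σ : ℝ} (h : ρ ≤ σ) :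
    bohrBall n ρ ⊆ bohrBall n σ := by
  intro x
  simpa using fun hx : n x ≤ ρ => hx.trans h

section BohrNorm

variable {H : Type*} [AddCommGroup H]

lemma isBohrNorm_zero : IsBohrNorm (fun _ : H => (0 : ℝ)) 0 where
  zero := rfl
  nonneg _ := le_rfl
  neg _ := rfl
  add_le _ _ := by simp
  le_two _ := by norm_num
  cover ρ hρ := ⟨fun _ => 0, fun _ _ _ _ _ => hρ.le⟩

lemma IsBohrNorm.comp_equiv {n : H → ℝ} {d : ℕ} (hn : IsBohrNorm n d) (e : H ≃+ H) :
    IsBohrNorm (fun x => n (e x)) d where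
  zero := by simp [hn.zero]
  nonneg x := hn.nonneg _
  neg x := by simp [hn.neg]
  add_le x y := by simpa using hn.add_le (e x) (e y)
  le_two x := hn.le_two _
  cover ρ hρ := by
    obtain ⟨c, hc⟩ := hn.cover ρ hρ
    refine ⟨fun x => c (e x), fun x y hx hy hxy => ?_⟩
    simpa using hc _ _ hx hy hxy

/-- A colouring by a small type gives a colouring by `Fin`. -/
lemma exists_fin_colouring {κ : Type*} [Fintype κ] {N : ℕ} (h : Fintype.card κ ≤ N) :
    ∃ f : κ → Fin N, Function.Injective f := by
  obtain ⟨f⟩ := Function.Embedding.nonempty_of_card_le (α := κ) (β := Fin N) (by simpa using h)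
  exact ⟨f, f.injective⟩

lemma exists_interval_colouring {ρ : ℝ} (hρ : 0 < ρ) :
    ∃ c : ℝ → Fin 9, ∀ x y, |x| ≤ 2 * ρ → |y| ≤ 2 * ρ → c x = c y → |x - y| ≤ ρ / 2 := by
  refine ⟨fun x => if h : ⌊(x + 2 * ρ) * (2 / ρ)⌋.toNat < 9 then
    ⟨⌊(x + 2 * ρ) * (2 / ρ)⌋.toNat, h⟩ else 0, fun x y hx hy hxy => ?_⟩
  have key : ∀ z : ℝ, |z| ≤ 2 * ρ → 0 ≤ ⌊(z + 2 * ρ) * (2 / ρ)⌋ ∧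
      ⌊(z + 2 * ρ) * (2 / ρ)⌋ ≤ 8 := by
    intro z hz
    rw [abs_le] at hz
    have h0 : 0 < 2 / ρ := by positivity
    constructor
    · apply Int.floor_nonneg.2
      apply mul_nonneg _ h0.le
      linarith
    · have : (z + 2 * ρ) * (2 / ρ) ≤ 8 := by
        calc (z + 2 * ρ) * (2 / ρ) ≤ (4 * ρ) * (2 / ρ) := by gcongr; linarith
          _ = 8 := by field_simp; norm_num
      have h2 := Int.floor_le_floor this
      simpa using h2
  obtain ⟨hx0, hx8⟩ := key x hx
  obtain ⟨hy0, hy8⟩ := key y hy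
  have hx9 : ⌊(x + 2 * ρ) * (2 / ρ)⌋.toNat < 9 := by omega
  have hy9 : ⌊(y + 2 * ρ) * (2 / ρ)⌋.toNat < 9 := by omega
  simp only [dif_pos hx9, dif_pos hy9, Fin.mk.injEq] at hxy
  have hfl : ⌊(x + 2 * ρ) * (2 / ρ)⌋ = ⌊(y + 2 * ρ) * (2 / ρ)⌋ := by omega
  have h1 := Int.abs_sub_lt_one_of_floor_eq_floor hfl
  have h2 : (x + 2 * ρ) * (2 / ρ) - (y + 2 * ρ) * (2 / ρ) = (x - y) * (2 / ρ) := by ring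
  rw [h2, abs_mul, abs_of_pos (show 0 < 2 / ρ by positivity), ← lt_div_iff₀ (by positivity)] at h1
  refine h1.le.trans (le_of_eq ?_)
  field_simp

lemma isBohrNorm_addChar [Finite H] (γ : AddChar H ℂ) : IsBohrNorm (fun x => ‖γ x - 1‖) 1 where
  zero := by simp
  nonneg _ := norm_nonneg _
  neg x := by
    have h1 : γ (-x) * γ x = 1 := by rw [← AddChar.map_add_eq_mul]; simp
    have h2 : ‖γ x‖ = 1 := AddChar.norm_apply γ x
    calc ‖γ (-x) - 1‖ = ‖γ (-x) - 1‖ * ‖γ x‖ := by rw [h2, mul_one]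
      _ = ‖1 - γ x‖ := by rw [← norm_mul, sub_mul, h1, one_mul]
      _ = ‖γ x - 1‖ := norm_sub_rev _ _
  add_le x y := by
    have h2 : ‖γ x‖ = 1 := AddChar.norm_apply γ x
    calc ‖γ (x + y) - 1‖ = ‖γ x * (γ y - 1) + (γ x - 1)‖ := by
          rw [AddChar.map_add_eq_mul]; ring_nf
      _ ≤ ‖γ x * (γ y - 1)‖ + ‖γ x - 1‖ := norm_add_le _ _
      _ = ‖γ x - 1‖ + ‖γ y - 1‖ := by rw [norm_mul, h2]; ring
  le_two x := by
    calc ‖γ x - 1‖ ≤ ‖γ x‖ + ‖(1 : ℂ)‖ := norm_sub_le _ _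
      _ = 2 := by rw [AddChar.norm_apply γ x]; norm_num
  cover ρ hρ := by
    obtain ⟨c, hc⟩ := exists_interval_colouring hρ
    obtain ⟨f, hf⟩ := exists_fin_colouring (κ := Fin 9 × Fin 9) (N := 2 ^ (7 * 1)) (by simp)
    refine ⟨fun x => f (c (γ x - 1).re, c (γ x - 1).im), fun x y hx hy hxy => ?_⟩
    have h := hf hxy
    simp only [Prod.mk.injEq] at h
    have h1 := hc _ _ ((Complex.abs_re_le_norm _).trans hx) ((Complex.abs_re_le_norm _).trans hy) h.1
    have h2 := hc _ _ ((Complex.abs_im_le_norm _).trans hx) ((Complex.abs_im_le_norm _).trans hy) h.2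
    have h3 : ‖γ y‖ = 1 := AddChar.norm_apply γ y
    have h4 : γ (x - y) * γ y = γ x := by rw [← AddChar.map_add_eq_mul]; simp
    calc ‖γ (x - y) - 1‖ = ‖γ (x - y) - 1‖ * ‖γ y‖ := by rw [h3, mul_one]
      _ = ‖(γ x - 1) - (γ y - 1)‖ := by rw [← norm_mul, sub_mul, h4, one_mul]; ring_nf
      _ ≤ |((γ x - 1) - (γ y - 1)).re| + |((γ x - 1) - (γ y - 1)).im| :=
          Complex.norm_le_abs_re_add_abs_im _
      _ ≤ ρ / 2 + ρ / 2 := by rw [Complex.sub_re, Complex.sub_im]; exact add_le_add h1 h2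
      _ = ρ := by ring

lemma IsBohrNorm.max {n n' : H → ℝ} {d d' : ℕ} (hn : IsBohrNorm n d) (hn' : IsBohrNorm n' d') :
    IsBohrNorm (fun x => max (n x) (n' x)) (d + d') where
  zero := by simp [hn.zero, hn'.zero]
  nonneg x := le_max_of_le_left (hn.nonneg x)
  neg x := by simp [hn.neg, hn'.neg]
  add_le x y := max_le
    ((hn.add_le x y).trans (add_le_add (le_max_left _ _) (le_max_left _ _)))
    ((hn'.add_le x y).trans (add_le_add (le_max_right _ _) (le_max_right _ _)))
  le_two x := max_le (hn.le_two x) (hn'.le_two x)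
  cover ρ hρ := by
    obtain ⟨c, hc⟩ := hn.cover ρ hρ
    obtain ⟨c', hc'⟩ := hn'.cover ρ hρ
    obtain ⟨f, hf⟩ := exists_fin_colouring (κ := Fin (2 ^ (7 * d)) × Fin (2 ^ (7 * d')))
      (N := 2 ^ (7 * (d + d'))) (by simp [mul_add, pow_add])
    refine ⟨fun x => f (c x, c' x), fun x y hx hy hxy => ?_⟩
    have h := hf hxy
    simp only [Prod.mk.injEq] at h
    exact max_le (hc x y ((le_max_left _ _).trans hx) ((le_max_left _ _).trans hy) h.1)
      (hc' x y ((le_max_right _ _).trans hx) ((le_max_right _ _).trans hy) h.2)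

lemma IsBohrNorm.pi {n : H → ℝ} {d : ℕ} (hn : IsBohrNorm n d) (ι : Type*) [Fintype ι] :
    IsBohrNorm (fun x : ι → H => ⨆ k, n (x k)) (d * Fintype.card ι) where
  zero := by simp [hn.zero]
  nonneg x := Real.iSup_nonneg fun k => hn.nonneg _
  neg x := by simp [hn.neg]
  add_le x y := by
    refine Real.iSup_le (fun k => (hn.add_le _ _).trans (add_le_add ?_ ?_))
      (add_nonneg (Real.iSup_nonneg fun k => hn.nonneg _) (Real.iSup_nonneg fun k => hn.nonneg _))
    · exact le_ciSup (f := fun k => n (x k)) (Set.finite_range _).bddAbove k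
    · exact le_ciSup (f := fun k => n (y k)) (Set.finite_range _).bddAbove k
  le_two x := Real.iSup_le (fun k => hn.le_two _) (by norm_num)
  cover ρ hρ := by
    obtain ⟨c, hc⟩ := hn.cover ρ hρ
    obtain ⟨f, hf⟩ := exists_fin_colouring (κ := ι → Fin (2 ^ (7 * d)))
      (N := 2 ^ (7 * (d * Fintype.card ι))) (by simp [← pow_mul, mul_assoc])
    refine ⟨fun x => f fun k => c (x k), fun x y hx hy hxy => ?_⟩
    have h := hf hxy
    refine Real.iSup_le (fun k => hc _ _ ?_ ?_ (congrFun h k)) hρ.le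
    · exact (le_ciSup (f := fun k => n (x k)) (Set.finite_range _).bddAbove k).trans hx
    · exact (le_ciSup (f := fun k => n (y k)) (Set.finite_range _).bddAbove k).trans hy

lemma IsBohrNorm.zsmul_le {n : H → ℝ} {d : ℕ} (hn : IsBohrNorm n d) (z : ℤ) (x : H) :
    n (z • x) ≤ |(z : ℝ)| * n x := by
  have hnat : ∀ k : ℕ, n (k • x) ≤ k * n x := by
    intro k
    induction k with
    | zero => simp [hn.zero]
    | succ k ih =>
      rw [succ_nsmul]
      refine (hn.add_le _ _).trans ?_
      push_cast
      linarith
  obtain ⟨k, rfl | rfl⟩ := z.eq_nat_or_neg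
  · simpa using hnat k
  · simpa [hn.neg] using hnat k

lemma IsBohrNorm.sum_le {n : H → ℝ} {d : ℕ} (hn : IsBohrNorm n d) {ι : Type*} (s : Finset ι)
    (f : ι → H) : n (∑ k ∈ s, f k) ≤ ∑ k ∈ s, n (f k) := by
  induction s using Finset.induction_on with
  | empty => simp [hn.zero]
  | insert a s ha ih =>
    rw [sum_insert ha, sum_insert ha]
    exact (hn.add_le _ _).trans (by linarith)

variable [Fintype H]

lemma IsBohrNorm.bohrBall_nonempty {n : H → ℝ} {d : ℕ} (hn : IsBohrNorm n d) {ρ : ℝ}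
    (hρ : 0 ≤ ρ) : (bohrBall n ρ).Nonempty := ⟨0, by simp [hn.zero, hρ]⟩

lemma IsBohrNorm.card_doubling {n : H → ℝ} {d : ℕ} (hn : IsBohrNorm n d) {ρ : ℝ} (hρ : 0 < ρ) :
    #(bohrBall n (2 * ρ)) ≤ 2 ^ (7 * d) * #(bohrBall n ρ) := by
  obtain ⟨c, hc⟩ := hn.cover ρ hρ
  have h := Finset.card_le_mul_card_image_of_maps_to (s := bohrBall n (2 * ρ))
    (t := (univ : Finset (Fin (2 ^ (7 * d))))) (f := c) (fun _ _ => mem_univ _) #(bohrBall n ρ) ?_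
  · simpa [mul_comm] using h
  intro b _
  rcases ((bohrBall n (2 * ρ)).filter fun a => c a = b).eq_empty_or_nonempty with h | ⟨x₀, hx₀⟩
  · simp [h]
  · refine Finset.card_le_card_of_injOn (fun x => x - x₀) ?_ (fun x _ y _ h => by simpa using h)
    intro x hx
    simp only [coe_filter, Set.mem_ofPred_eq, mem_bohrBall, mem_filter, mem_coe] at hx hx₀ ⊢
    exact hc _ _ hx.1 hx₀.1 (hx.2.trans hx₀.2.symm)

lemma IsBohrNorm.card_le {n : H → ℝ} {d : ℕ} (hn : IsBohrNorm n d) (j : ℕ) :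
    Fintype.card H ≤ 2 ^ (7 * d * j) * #(bohrBall n (2 / 2 ^ j)) := by
  induction j with
  | zero =>
    have : bohrBall n (2 / 2 ^ 0) = univ := by
      ext x
      simpa using hn.le_two x
    rw [this]
    simp
  | succ j ih =>
    have h := hn.card_doubling (ρ := 2 / 2 ^ (j + 1)) (by positivity)
    have h2 : (2 : ℝ) * (2 / 2 ^ (j + 1)) = 2 / 2 ^ j := by
      rw [pow_succ]; field_simp
    rw [h2] at h
    calc Fintype.card H ≤ 2 ^ (7 * d * j) * #(bohrBall n (2 / 2 ^ j)) := ih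
      _ ≤ 2 ^ (7 * d * j) * (2 ^ (7 * d) * #(bohrBall n (2 / 2 ^ (j + 1)))) := by gcongr
      _ = 2 ^ (7 * d * (j + 1)) * #(bohrBall n (2 / 2 ^ (j + 1))) := by ring

/-- Every scale has, up to a factor two, a radius at which the ball grows slowly. -/
lemma IsBohrNorm.exists_regular {n : H → ℝ} {d : ℕ} (hn : IsBohrNorm n d) {E M : ℕ}
    (hE : 0 < E) (hM : 0 < M) (hdM : 7 * d * E ≤ M) {s : ℝ} (hs : 0 < s) :
    ∃ σ : ℝ, s ≤ σ ∧ σ ≤ 2 * s ∧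
      (#(bohrBall n (σ + s / M)) : ℝ) ≤ (1 + 1 / E) * #(bohrBall n σ) := by
  by_contra! hcon
  have hE' : (0 : ℝ) < E := by exact_mod_cast hE
  have hM' : (0 : ℝ) < M := by exact_mod_cast hM
  have hgrow : ∀ j : ℕ, j ≤ M → (1 + 1 / (E : ℝ)) ^ j * #(bohrBall n s) ≤
      #(bohrBall n (s + j * (s / M))) := by
    intro j
    induction j with
    | zero => simp
    | succ j ih =>
      intro hj
      have hjM : (j : ℝ) ≤ M := by exact_mod_cast (Nat.le_of_succ_le hj)
      have h1 := hcon (s + j * (s / M)) (by have : 0 ≤ (j : ℝ) * (s / M) := by positivity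
                                            linarith) (by
        have : (j : ℝ) * (s / M) ≤ M * (s / M) := by gcongr
        have h3 : (M : ℝ) * (s / M) = s := by field_simp
        linarith)
      have h2 := ih (Nat.le_of_succ_le hj)
      have h4 : s + ((j + 1 : ℕ) : ℝ) * (s / M) = s + j * (s / M) + s / M := by push_cast; ring
      rw [h4]
      calc (1 + 1 / (E : ℝ)) ^ (j + 1) * #(bohrBall n s)
          = (1 + 1 / (E : ℝ)) * ((1 + 1 / (E : ℝ)) ^ j * #(bohrBall n s)) := by ring
        _ ≤ (1 + 1 / (E : ℝ)) * #(bohrBall n (s + j * (s / M))) := by gcongr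
        _ ≤ _ := h1.le
  have hpos : (0 : ℝ) < #(bohrBall n s) := by
    exact_mod_cast (hn.bohrBall_nonempty hs.le).card_pos
  have h2 : (1 + 1 / (E : ℝ)) ^ M * #(bohrBall n s) < (2 : ℝ) ^ (7 * d) * #(bohrBall n s) := by
    have hM1 : ((M - 1 : ℕ) : ℝ) = M - 1 := by
      rw [Nat.cast_sub hM]; simp
    have h3 := hgrow (M - 1) (Nat.sub_le _ _)
    have hlast := hcon (s + (M - 1 : ℕ) * (s / M)) (by
        have : 0 ≤ ((M - 1 : ℕ) : ℝ) * (s / M) := by positivity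
        linarith) (by
        have : ((M - 1 : ℕ) : ℝ) * (s / M) ≤ M * (s / M) := by gcongr; exact Nat.sub_le _ _
        have h3 : (M : ℝ) * (s / M) = s := by field_simp
        linarith)
    have h4 : s + ((M - 1 : ℕ) : ℝ) * (s / M) + s / M = 2 * s := by
      rw [hM1]; field_simp; ring
    rw [h4] at hlast
    have h5 : (#(bohrBall n (2 * s)) : ℝ) ≤ (2 : ℝ) ^ (7 * d) * #(bohrBall n s) := by
      exact_mod_cast hn.card_doubling hs
    calc (1 + 1 / (E : ℝ)) ^ M * #(bohrBall n s)
        = (1 + 1 / (E : ℝ)) * ((1 + 1 / (E : ℝ)) ^ (M - 1) * #(bohrBall n s)) := by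
          rw [← mul_assoc, ← pow_succ', Nat.sub_add_cancel hM]
      _ ≤ (1 + 1 / (E : ℝ)) * #(bohrBall n (s + (M - 1 : ℕ) * (s / M))) := by gcongr
      _ < _ := hlast.trans_le h5
  have h3 : (1 + 1 / (E : ℝ)) ^ M < (2 : ℝ) ^ (7 * d) := lt_of_mul_lt_mul_right h2 hpos.le
  have h4 : (2 : ℝ) ≤ (1 + 1 / (E : ℝ)) ^ E := by
    have := one_add_mul_le_pow (a := 1 / (E : ℝ)) (by have : 0 < 1 / (E : ℝ) := by positivity
                                                      linarith) E
    have h5 : (E : ℝ) * (1 / E) = 1 := by field_simp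
    linarith
  have h5 : (2 : ℝ) ^ (7 * d) ≤ (1 + 1 / (E : ℝ)) ^ M := by
    calc (2 : ℝ) ^ (7 * d) ≤ ((1 + 1 / (E : ℝ)) ^ E) ^ (7 * d) := by gcongr
      _ = (1 + 1 / (E : ℝ)) ^ (7 * d * E) := by rw [← pow_mul, mul_comm]
      _ ≤ (1 + 1 / (E : ℝ)) ^ M :=
        pow_le_pow_right₀ (by have : 0 < 1 / (E : ℝ) := by positivity
                              linarith) hdM
  linarith

end BohrNorm

section Fourier

variable {G : Type*} [AddCommGroup G] [Fintype G]

lemma sum_norm_sq_fourier (Q : G → ℂ) :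
    ∑ γ : AddChar G ℂ, ‖∑ x, Q x * γ x‖ ^ 2 = Fintype.card G * ∑ x, ‖Q x‖ ^ 2 := by
  have key : ∑ γ : AddChar G ℂ, (∑ x, Q x * γ x) * (starRingEnd ℂ) (∑ x, Q x * γ x) =
      Fintype.card G * ∑ x, Q x * (starRingEnd ℂ) (Q x) := by
    calc ∑ γ : AddChar G ℂ, (∑ x, Q x * γ x) * (starRingEnd ℂ) (∑ x, Q x * γ x)
        = ∑ γ : AddChar G ℂ, ∑ x, ∑ y, (Q x * (starRingEnd ℂ) (Q y)) * γ (x - y) := by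
          refine sum_congr rfl fun γ _ => ?_
          rw [map_sum, sum_mul_sum]
          refine sum_congr rfl fun x _ => sum_congr rfl fun y _ => ?_
          rw [sub_eq_add_neg, AddChar.map_add_eq_mul, AddChar.map_neg_eq_conj, map_mul]
          ring
      _ = ∑ x, ∑ y, (Q x * (starRingEnd ℂ) (Q y)) * ∑ γ : AddChar G ℂ, γ (x - y) := by
          rw [sum_comm]
          refine sum_congr rfl fun x _ => ?_
          rw [sum_comm]
          refine sum_congr rfl fun y _ => ?_
          rw [mul_sum]
      _ = Fintype.card G * ∑ x, Q x * (starRingEnd ℂ) (Q x) := by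
          rw [mul_sum]
          refine sum_congr rfl fun x _ => ?_
          simp only [AddChar.sum_apply_eq_ite, sub_eq_zero]
          simp [mul_comm]
  simp only [Complex.mul_conj, Complex.normSq_eq_norm_sq] at key
  exact_mod_cast key

/-- Convolution by `g` has `ℓ²` operator norm at most the largest Fourier coefficient of `g`. -/
lemma sum_norm_sq_conv_le (F g : G → ℂ) (B : Finset G) {M : ℝ}
    (hM : ∀ γ : AddChar G ℂ, ‖∑ b ∈ B, g b * γ b‖ ≤ M) :
    ∑ x, ‖∑ b ∈ B, F (x + b) * g b‖ ^ 2 ≤ M ^ 2 * ∑ x, ‖F x‖ ^ 2 := by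
  have hpos : (0 : ℝ) < Fintype.card G := by exact_mod_cast Fintype.card_pos
  have hQ : ∀ γ : AddChar G ℂ, ∑ x, (∑ b ∈ B, F (x + b) * g b) * γ x =
      (∑ b ∈ B, g b * (γ⁻¹) b) * ∑ x, F x * γ x := by
    intro γ
    calc ∑ x, (∑ b ∈ B, F (x + b) * g b) * γ x
        = ∑ b ∈ B, ∑ x, F (x + b) * g b * γ x := by
          rw [sum_comm]
          exact sum_congr rfl fun x _ => sum_mul _ _ _
      _ = ∑ b ∈ B, ∑ x, F x * g b * γ (x - b) := by
          refine sum_congr rfl fun b _ => ?_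
          exact Fintype.sum_equiv (Equiv.addRight b) _ _ (fun x => by simp)
      _ = (∑ b ∈ B, g b * (γ⁻¹) b) * ∑ x, F x * γ x := by
          rw [sum_mul_sum]
          refine sum_congr rfl fun b _ => sum_congr rfl fun x _ => ?_
          rw [AddChar.inv_apply, sub_eq_add_neg, AddChar.map_add_eq_mul]
          ring
  have h1 := sum_norm_sq_fourier fun x => ∑ b ∈ B, F (x + b) * g b
  have h2 := sum_norm_sq_fourier F
  have h3 : Fintype.card G * ∑ x, ‖∑ b ∈ B, F (x + b) * g b‖ ^ 2 ≤
      Fintype.card G * (M ^ 2 * ∑ x, ‖F x‖ ^ 2) := by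
    rw [← h1, mul_left_comm, ← h2, mul_sum]
    refine sum_le_sum fun γ _ => ?_
    rw [hQ, norm_mul, mul_pow]
    gcongr
    exact hM _
  exact le_of_mul_le_mul_left h3 hpos

/-- A local generalized von Neumann inequality: a bilinear average of `φ (a + b)` against bounded
functions of `a` and of `b` is controlled by local Fourier coefficients of `φ`. -/
lemma abs_sum_pow_four_le (B₁ B₂ U : Finset G) (hU : ∀ a ∈ B₁, ∀ b ∈ B₂, a + b ∈ U)
    (φ g h : G → ℝ) (hφ : ∀ x, |φ x| ≤ 1) (hg : ∀ x, |g x| ≤ 1) (hh : ∀ x, |h x| ≤ 1)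
    (κ : G → ℝ) (hκ : ∀ a ∈ B₁, ∀ γ : AddChar G ℂ, ‖∑ b ∈ B₂, (φ (a + b) : ℂ) * γ b‖ ≤ κ a) :
    (∑ a ∈ B₁, ∑ b ∈ B₂, φ (a + b) * g b * h a) ^ 4 ≤
      (#B₁ : ℝ) ^ 2 * (#B₂ : ℝ) ^ 2 * (#U * ∑ a ∈ B₁, κ a ^ 2) := by
  have hsq : ∀ x : ℝ, |x| ≤ 1 → x ^ 2 ≤ 1 := fun x hx => (sq_le_one_iff_abs_le_one x).2 hx
  have step1 : (∑ a ∈ B₁, ∑ b ∈ B₂, φ (a + b) * g b * h a) ^ 2 ≤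
      #B₁ * ∑ b ∈ B₂, ∑ b' ∈ B₂, |∑ a ∈ B₁, φ (a + b) * φ (a + b')| := by
    calc (∑ a ∈ B₁, ∑ b ∈ B₂, φ (a + b) * g b * h a) ^ 2
        = (∑ a ∈ B₁, h a * ∑ b ∈ B₂, φ (a + b) * g b) ^ 2 := by
          congr 1
          refine sum_congr rfl fun a _ => ?_
          rw [mul_sum]
          exact sum_congr rfl fun b _ => by ring
      _ ≤ (∑ a ∈ B₁, h a ^ 2) * ∑ a ∈ B₁, (∑ b ∈ B₂, φ (a + b) * g b) ^ 2 :=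
          sum_mul_sq_le_sq_mul_sq _ _ _
      _ ≤ #B₁ * ∑ a ∈ B₁, (∑ b ∈ B₂, φ (a + b) * g b) ^ 2 := by
          gcongr
          calc ∑ a ∈ B₁, h a ^ 2 ≤ ∑ a ∈ B₁, (1 : ℝ) := sum_le_sum fun a _ => hsq _ (hh a)
            _ = #B₁ := by simp
      _ = #B₁ * ∑ b ∈ B₂, ∑ b' ∈ B₂, (g b * g b') * ∑ a ∈ B₁, φ (a + b) * φ (a + b') := by
          congr 1
          calc ∑ a ∈ B₁, (∑ b ∈ B₂, φ (a + b) * g b) ^ 2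
              = ∑ a ∈ B₁, ∑ b ∈ B₂, ∑ b' ∈ B₂, (g b * g b') * (φ (a + b) * φ (a + b')) := by
                refine sum_congr rfl fun a _ => ?_
                rw [sq, sum_mul_sum]
                exact sum_congr rfl fun b _ => sum_congr rfl fun b' _ => by ring
            _ = _ := by
                rw [sum_comm]
                refine sum_congr rfl fun b _ => ?_
                rw [sum_comm]
                refine sum_congr rfl fun b' _ => ?_
                rw [mul_sum]
      _ ≤ #B₁ * ∑ b ∈ B₂, ∑ b' ∈ B₂, |∑ a ∈ B₁, φ (a + b) * φ (a + b')| := by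
          gcongr with b _ b' _
          refine (le_abs_self _).trans ?_
          rw [abs_mul]
          refine mul_le_of_le_one_left (abs_nonneg _) ?_
          rw [abs_mul]
          exact mul_le_one₀ (hg b) (abs_nonneg _) (hg b')
  have step2 : (∑ b ∈ B₂, ∑ b' ∈ B₂, |∑ a ∈ B₁, φ (a + b) * φ (a + b')|) ^ 2 ≤
      (#B₂ : ℝ) ^ 2 * ∑ a' ∈ B₁, ∑ a ∈ B₁, (∑ b ∈ B₂, φ (a + b) * φ (a' + b)) ^ 2 := by
    rw [← sum_product']
    refine (sq_sum_le_card_mul_sum_sq).trans ?_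
    rw [card_product]
    push_cast
    rw [← sq]
    gcongr
    refine le_of_eq ?_
    simp only [sq_abs]
    rw [sum_product' (f := fun b b' => (∑ a ∈ B₁, φ (a + b) * φ (a + b')) ^ 2)]
    calc ∑ b ∈ B₂, ∑ b' ∈ B₂, (∑ a ∈ B₁, φ (a + b) * φ (a + b')) ^ 2
        = ∑ b ∈ B₂, ∑ b' ∈ B₂, ∑ a' ∈ B₁, ∑ a ∈ B₁,
            φ (a + b) * φ (a' + b) * (φ (a + b') * φ (a' + b')) := by
          refine sum_congr rfl fun b _ => sum_congr rfl fun b' _ => ?_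
          rw [sq, sum_mul_sum, sum_comm]
          exact sum_congr rfl fun a' _ => sum_congr rfl fun a _ => by ring
      _ = ∑ b ∈ B₂, ∑ a' ∈ B₁, ∑ a ∈ B₁, ∑ b' ∈ B₂,
            φ (a + b) * φ (a' + b) * (φ (a + b') * φ (a' + b')) := by
          refine sum_congr rfl fun b _ => ?_
          rw [sum_comm]
          exact sum_congr rfl fun a' _ => sum_comm
      _ = ∑ a' ∈ B₁, ∑ a ∈ B₁, ∑ b ∈ B₂, ∑ b' ∈ B₂,
            φ (a + b) * φ (a' + b) * (φ (a + b') * φ (a' + b')) := by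
          rw [sum_comm]
          exact sum_congr rfl fun a' _ => sum_comm
      _ = _ := by
          refine sum_congr rfl fun a' _ => sum_congr rfl fun a _ => ?_
          rw [sq, sum_mul_sum]
  have step3 : ∀ a' ∈ B₁, ∑ a ∈ B₁, (∑ b ∈ B₂, φ (a + b) * φ (a' + b)) ^ 2 ≤
      #U * κ a' ^ 2 := by
    intro a' ha'
    have h1 := sum_norm_sq_conv_le (fun x => if x ∈ U then (φ x : ℂ) else 0)
      (fun b => (φ (a' + b) : ℂ)) B₂ (hκ a' ha')
    have h2 : ∑ x, ‖(if x ∈ U then (φ x : ℂ) else 0)‖ ^ 2 ≤ (#U : ℝ) := by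
      calc ∑ x, ‖(if x ∈ U then (φ x : ℂ) else 0)‖ ^ 2
          ≤ ∑ x, (if x ∈ U then (1 : ℝ) else 0) := by
            refine sum_le_sum fun x _ => ?_
            split_ifs
            · rw [Complex.norm_real, Real.norm_eq_abs, sq_abs]
              exact hsq _ (hφ x)
            · simp
        _ = #U := by simp
    calc ∑ a ∈ B₁, (∑ b ∈ B₂, φ (a + b) * φ (a' + b)) ^ 2
        = ∑ a ∈ B₁, ‖∑ b ∈ B₂, (if a + b ∈ U then (φ (a + b) : ℂ) else 0) *
            (φ (a' + b) : ℂ)‖ ^ 2 := by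
          refine sum_congr rfl fun a ha => ?_
          have : ∑ b ∈ B₂, (if a + b ∈ U then (φ (a + b) : ℂ) else 0) * (φ (a' + b) : ℂ) =
              ((∑ b ∈ B₂, φ (a + b) * φ (a' + b) : ℝ) : ℂ) := by
            push_cast
            exact sum_congr rfl fun b hb => by rw [if_pos (hU a ha b hb)]
          rw [this, Complex.norm_real, Real.norm_eq_abs, sq_abs]
      _ ≤ ∑ a, ‖∑ b ∈ B₂, (if a + b ∈ U then (φ (a + b) : ℂ) else 0) *
            (φ (a' + b) : ℂ)‖ ^ 2 :=
          sum_le_sum_of_subset_of_nonneg (subset_univ _) fun _ _ _ => by positivity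
      _ ≤ κ a' ^ 2 * ∑ x, ‖(if x ∈ U then (φ x : ℂ) else 0)‖ ^ 2 := h1
      _ ≤ κ a' ^ 2 * #U := by gcongr
      _ = #U * κ a' ^ 2 := mul_comm _ _
  calc (∑ a ∈ B₁, ∑ b ∈ B₂, φ (a + b) * g b * h a) ^ 4
      = ((∑ a ∈ B₁, ∑ b ∈ B₂, φ (a + b) * g b * h a) ^ 2) ^ 2 := by ring
    _ ≤ (#B₁ * ∑ b ∈ B₂, ∑ b' ∈ B₂, |∑ a ∈ B₁, φ (a + b) * φ (a + b')|) ^ 2 := by gcongr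
    _ = (#B₁ : ℝ) ^ 2 * (∑ b ∈ B₂, ∑ b' ∈ B₂, |∑ a ∈ B₁, φ (a + b) * φ (a + b')|) ^ 2 := by
        rw [mul_pow]
    _ ≤ (#B₁ : ℝ) ^ 2 * ((#B₂ : ℝ) ^ 2 *
          ∑ a' ∈ B₁, ∑ a ∈ B₁, (∑ b ∈ B₂, φ (a + b) * φ (a' + b)) ^ 2) := by gcongr
    _ ≤ (#B₁ : ℝ) ^ 2 * ((#B₂ : ℝ) ^ 2 * ∑ a' ∈ B₁, #U * κ a' ^ 2) := by
        gcongr with a' ha'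
        exact step3 a' ha'
    _ = _ := by rw [← mul_sum]; ring

end Fourier

section AlmostInvariant

/-- The uniform measure on `S` changes by at most `ε` in total variation under translation
by `s`. -/
def AlmostInv {H : Type*} [AddCommGroup H] (S : Finset H) (s : H) (ε : ℝ) : Prop :=
  ∀ F : H → ℂ, (∀ x, ‖F x‖ ≤ 1) → ‖𝔼 x ∈ S, F (x + s) - 𝔼 x ∈ S, F x‖ ≤ ε

lemma ofReal_expect {κ : Type*} (s : Finset κ) (f : κ → ℝ) :
    ((𝔼 i ∈ s, f i : ℝ) : ℂ) = 𝔼 i ∈ s, (f i : ℂ) := by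
  simp [expect_eq_sum_div_card]

variable {H : Type*} [AddCommGroup H]

lemma AlmostInv.real {S : Finset H} {s : H} {ε : ℝ} (h : AlmostInv S s ε) (F : H → ℝ)
    (hF : ∀ x, |F x| ≤ 1) : |𝔼 x ∈ S, F (x + s) - 𝔼 x ∈ S, F x| ≤ ε := by
  have h1 := h (fun x => (F x : ℂ)) (fun x => by simpa using hF x)
  rw [← ofReal_expect, ← ofReal_expect S fun x => F x, ← Complex.ofReal_sub, Complex.norm_real,
    Real.norm_eq_abs] at h1
  exact h1

lemma AlmostInv.image [DecidableEq H] {S : Finset H} {s : H} {ε : ℝ} (h : AlmostInv S s ε) (e : H ≃+ H) (v : H) :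
    AlmostInv (S.image fun c => v + e c) (e s) ε := by
  have hinj : Set.InjOn (fun c => v + e c) (S : Set H) := fun x _ y _ hxy => by simpa using hxy
  intro F hF
  have h1 := h (fun c => F (v + e c)) (fun c => hF _)
  rw [expect_image hinj, expect_image hinj]
  simpa [add_assoc] using h1

variable [Fintype H]

lemma IsBohrNorm.almostInv {n : H → ℝ} {d : ℕ} (hn : IsBohrNorm n d) {σ δ ε : ℝ} (hσ : 0 ≤ σ)
    (hreg : (#(bohrBall n (σ + δ)) : ℝ) ≤ (1 + ε / 2) * #(bohrBall n σ)) {s : H} (hs : n s ≤ δ) :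
    AlmostInv (bohrBall n σ) s ε := by
  intro F hF
  set B := bohrBall n σ with hB
  set B' := B.image (· + s) with hB'
  have hcard : #B' = #B := card_image_of_injective _ (add_left_injective s)
  have hδ : 0 ≤ δ := (hn.nonneg s).trans hs
  have hBpos : (0 : ℝ) < #B := by exact_mod_cast (hn.bohrBall_nonempty hσ).card_pos
  have hsub : B ∪ B' ⊆ bohrBall n (σ + δ) := by
    refine union_subset (bohrBall_mono n (by linarith)) ?_
    intro x hx
    obtain ⟨y, hy, rfl⟩ := mem_image.1 hx
    rw [hB, mem_bohrBall] at hy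
    exact mem_bohrBall.2 ((hn.add_le _ _).trans (add_le_add hy hs))
  have hun : (#(B ∪ B') : ℝ) ≤ (1 + ε / 2) * #B :=
    le_trans (by exact_mod_cast card_le_card hsub) hreg
  have h1 : (#(B' \ B) : ℝ) ≤ ε / 2 * #B := by
    have : (#(B ∪ B') : ℝ) = #B + #(B' \ B) := by
      rw [← union_sdiff_self_eq_union, card_union_of_disjoint disjoint_sdiff]
      push_cast; rfl
    linarith
  have h2 : (#(B \ B') : ℝ) ≤ ε / 2 * #B := by
    have := card_sdiff_comm hcard
    rw [← this]; exact h1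
  have hsum : ∑ x ∈ B, F (x + s) = ∑ x ∈ B', F x := by
    rw [hB', sum_image (fun x _ y _ h => by simpa using h)]
  have hbound : ∀ T : Finset H, ‖∑ x ∈ T, F x‖ ≤ #T := fun T =>
    (norm_sum_le _ _).trans ((sum_le_sum fun x _ => hF x).trans (by simp))
  have hdiff : ∑ x ∈ B', F x - ∑ x ∈ B, F x = ∑ x ∈ B' \ B, F x - ∑ x ∈ B \ B', F x :=
    (sum_sdiff_sub_sum_sdiff).symm
  rw [expect_eq_sum_div_card, expect_eq_sum_div_card, ← sub_div, norm_div, hsum, hdiff]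
  rw [Complex.norm_natCast, div_le_iff₀ hBpos]
  calc ‖∑ x ∈ B' \ B, F x - ∑ x ∈ B \ B', F x‖ ≤ ‖∑ x ∈ B' \ B, F x‖ + ‖∑ x ∈ B \ B', F x‖ :=
        norm_sub_le _ _
    _ ≤ ε / 2 * #B + ε / 2 * #B := add_le_add ((hbound _).trans h1) ((hbound _).trans h2)
    _ = ε * #B := by ring

/-- If `φ` has no density increment above `ζ` on translates of `C`, then its local Fourier
coefficient at a frequency that is almost constant on `C` is small, up to the mean of `φ`. -/
lemma norm_expect_mul_addChar_le {G : Type*} [AddCommGroup G] [Finite G] (φ : G → ℝ)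
    (hφ : ∀ x, |φ x| ≤ 1) (γ : AddChar G ℂ) {B C : Finset G} (hB : B.Nonempty) (hC : C.Nonempty)
    {ε ζ : ℝ} (hinv : ∀ c ∈ C, AlmostInv B c ε) (hγ : ∀ c ∈ C, ‖γ c - 1‖ ≤ ε) (hζ : 0 ≤ ζ)
    (hinc : ∀ b ∈ B, 𝔼 c ∈ C, φ (b + c) ≤ ζ) :
    ‖𝔼 b ∈ B, (φ b : ℂ) * γ b‖ + 𝔼 b ∈ B, φ b ≤ 2 * ζ + 3 * ε := by
  have hφ' : ∀ x, ‖(φ x : ℂ)‖ ≤ 1 := fun x => by simpa using hφ x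
  have hγ1 : ∀ x, ‖γ x‖ = 1 := fun x => AddChar.norm_apply γ x
  have h1 : ‖𝔼 c ∈ C, 𝔼 b ∈ B, (φ (b + c) : ℂ) * γ (b + c) - 𝔼 b ∈ B, (φ b : ℂ) * γ b‖ ≤ ε := by
    rw [← expect_const hC (𝔼 b ∈ B, (φ b : ℂ) * γ b), ← expect_sub_distrib]
    refine RCLike.norm_expect_le (K := ℂ) |>.trans (expect_le hC fun c hc => ?_)
    refine hinv c hc (fun x => (φ x : ℂ) * γ x) fun x => ?_
    rw [norm_mul, hγ1, mul_one]
    exact hφ' x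
  have h2 : ‖𝔼 c ∈ C, 𝔼 b ∈ B, (φ (b + c) : ℂ) * γ (b + c) -
      𝔼 c ∈ C, 𝔼 b ∈ B, (φ (b + c) : ℂ) * γ b‖ ≤ ε := by
    rw [← expect_sub_distrib]
    refine RCLike.norm_expect_le (K := ℂ) |>.trans (expect_le hC fun c hc => ?_)
    rw [← expect_sub_distrib]
    refine RCLike.norm_expect_le (K := ℂ) |>.trans (expect_le hB fun b hb => ?_)
    rw [AddChar.map_add_eq_mul,
      show (φ (b + c) : ℂ) * (γ b * γ c) - φ (b + c) * γ b = φ (b + c) * γ b * (γ c - 1) by ring,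
      norm_mul, norm_mul, hγ1, mul_one]
    exact (mul_le_of_le_one_left (norm_nonneg _) (hφ' _)).trans (hγ c hc)
  have h3 : ‖𝔼 c ∈ C, 𝔼 b ∈ B, (φ (b + c) : ℂ) * γ b‖ ≤ 2 * ζ - 𝔼 c ∈ C, 𝔼 b ∈ B, φ (b + c) := by
    rw [expect_comm, expect_comm C B fun c b => φ (b + c)]
    calc ‖𝔼 b ∈ B, 𝔼 c ∈ C, (φ (b + c) : ℂ) * γ b‖
        ≤ 𝔼 b ∈ B, ‖𝔼 c ∈ C, (φ (b + c) : ℂ) * γ b‖ := (RCLike.norm_expect_le (K := ℂ))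
      _ ≤ 𝔼 b ∈ B, (2 * ζ - 𝔼 c ∈ C, φ (b + c)) := by
          refine expect_le_expect fun b hb => ?_
          rw [← expect_mul, ← ofReal_expect, norm_mul, hγ1, mul_one, Complex.norm_real,
            Real.norm_eq_abs]
          have := hinc b hb
          exact abs_le.2 ⟨by linarith, by linarith⟩
      _ = _ := by rw [expect_sub_distrib, expect_const hB]
  have h4 : 𝔼 b ∈ B, φ b - ε ≤ 𝔼 c ∈ C, 𝔼 b ∈ B, φ (b + c) := by
    refine le_expect hC fun c hc => ?_
    have := (abs_le.1 ((hinv c hc).real φ hφ)).1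
    linarith
  have h5 : ‖𝔼 b ∈ B, (φ b : ℂ) * γ b‖ ≤ ‖𝔼 c ∈ C, 𝔼 b ∈ B, (φ (b + c) : ℂ) * γ b‖ + 2 * ε := by
    have h6 := norm_le_norm_add_norm_sub (𝔼 c ∈ C, 𝔼 b ∈ B, (φ (b + c) : ℂ) * γ (b + c))
      (𝔼 b ∈ B, (φ b : ℂ) * γ b)
    have h7 := norm_le_norm_add_norm_sub' (𝔼 c ∈ C, 𝔼 b ∈ B, (φ (b + c) : ℂ) * γ (b + c))
      (𝔼 c ∈ C, 𝔼 b ∈ B, (φ (b + c) : ℂ) * γ b)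
    linarith
  linarith

end AlmostInvariant

/-- The `j`-th coordinate of the solution with parameters `x` and `c`. -/
def solCoord (p : ℕ) {ι : Type*} [Fintype ι] {t : ℕ} (w : ι → Fin t → ℤ) (x : ZMod p)
    (c : ι → ZMod p) (j : Fin t) : ZMod p :=
  x + ∑ k, w k j • c k

lemma solCoord_add_single {p : ℕ} {ι : Type*} [Fintype ι] {t : ℕ} (w : ι → Fin t → ℤ) (x : ZMod p) (c : ι → ZMod p) (k : ι) (a : ZMod p)
    (j : Fin t) : solCoord p w x (c + Pi.single k a) j = solCoord p w x c j + w k j • a := by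
  have : ∑ l, w l j • (Pi.single k a : ι → ZMod p) l = w k j • a := by
    rw [sum_eq_single k (fun l _ hl => by simp [hl]) (by simp)]
    simp
  simp only [solCoord, Pi.add_apply, smul_add, sum_add_distrib, this, add_assoc]

/-- The indicator function of `A`. -/
noncomputable def ind {α : Type*} (A : Finset α) (x : α) : ℝ := if x ∈ A then 1 else 0

lemma ind_nonneg {α : Type*} (A : Finset α) (x : α) : 0 ≤ ind A x := by
  unfold ind; split_ifs <;> norm_num

lemma ind_le_one {α : Type*} (A : Finset α) (x : α) : ind A x ≤ 1 := by
  unfold ind; split_ifs <;> norm_num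

/-- Telescoping comparison of the number of solutions with the expected number. -/
lemma pow_sub_le_expect_prod {p : ℕ} {ι : Type*} [Fintype ι] {t : ℕ} {w : ι → Fin t → ℤ} (A : Finset (ZMod p)) {β : ℝ} (hβ0 : 0 ≤ β)
    (hβ1 : β ≤ 1) {S : Finset (ZMod p)} {P : Finset (ι → ZMod p)} (hS : S.Nonempty)
    (hP : P.Nonempty) {δ : ℝ}
    (hterm : ∀ i, ∀ g : Fin t → ZMod p → ℝ, (∀ j x, |g j x| ≤ 1) →
      |𝔼 x ∈ S, 𝔼 c ∈ P, (ind A (solCoord p w x c i) - β) *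
        ∏ j ∈ univ.erase i, g j (solCoord p w x c j)| ≤ δ) :
    β ^ t - t * δ ≤ 𝔼 x ∈ S, 𝔼 c ∈ P, ∏ j, ind A (solCoord p w x c j) := by
  set g : Fin t → Fin t → ZMod p → ℝ := fun i j x => if j < i then ind A x else β with hg
  have hexp : ∀ x c, ∏ j, ind A (solCoord p w x c j) = β ^ t +
      ∑ i, (ind A (solCoord p w x c i) - β) *
        ∏ j ∈ univ.erase i, g i j (solCoord p w x c j) := by
    intro x c
    have h1 := prod_add_ordered (univ : Finset (Fin t)) (fun _ => β)
      (fun i => ind A (solCoord p w x c i) - β)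
    simp only [add_sub_cancel, prod_const, card_univ, Fintype.card_fin] at h1
    rw [h1]
    congr 1
    refine sum_congr rfl fun i _ => ?_
    rw [mul_assoc]
    congr 1
    rw [← prod_filter_mul_prod_filter_not (univ.erase i) (fun j => j < i)]
    have e1 : (univ.erase i).filter (fun j => j < i) = univ.filter (fun j => j < i) := by
      ext j; simp; exact fun h => h.ne
    have e2 : (univ.erase i).filter (fun j => ¬ j < i) = univ.filter (fun j => i < j) := by
      ext j; simp only [mem_filter, mem_erase, mem_univ, true_and, and_true]
      constructor
      · rintro ⟨h1, h2⟩; exact lt_of_le_of_ne (not_lt.1 h2) (Ne.symm h1)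
      · exact fun h => ⟨h.ne', h.le.not_gt⟩
    rw [e1, e2]
    congr 1
    · refine prod_congr rfl fun j hj => ?_
      simp [hg, (mem_filter.1 hj).2]
    · rw [← prod_const]
      refine prod_congr rfl fun j hj => ?_
      simp [hg, (mem_filter.1 hj).2.le.not_gt]
  simp only [hexp, expect_add_distrib, expect_const hP, expect_const hS, expect_sum_comm]
  have h2 : |∑ i, 𝔼 x ∈ S, 𝔼 c ∈ P, (ind A (solCoord p w x c i) - β) *
        ∏ j ∈ univ.erase i, g i j (solCoord p w x c j)| ≤ t * δ := by
    refine (abs_sum_le_sum_abs _ _).trans ?_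
    refine (sum_le_sum fun i _ => hterm i (g i) fun j x => ?_).trans (by simp)
    simp only [hg]
    split_ifs
    · rw [abs_of_nonneg (ind_nonneg _ _)]; exact ind_le_one _ _
    · rw [abs_of_nonneg hβ0]; exact hβ1
  have := (abs_le.1 h2).1
  linarith

section VonNeumann

lemma expect_pow_four_le_of_split {p : ℕ} [Fact p.Prime] {ι : Type*} {t : ℕ} {w : ι → Fin t → ℤ} {i : Fin t} {k₁ k₂ : ι}
    (hk : w k₁ i = w k₂ i) (hsplit : ∀ j, j ≠ i → w k₁ j = 0 ∨ w k₂ j = 0)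
    (f : ZMod p → ℝ) (hf : ∀ x, |f x| ≤ 1) (g : Fin t → ZMod p → ℝ) (hg : ∀ j x, |g j x| ≤ 1)
    {B₁ B₂ U : Finset (ZMod p)} (hB₁ : B₁.Nonempty) (hB₂ : B₂.Nonempty)
    (hU : ∀ a ∈ B₁, ∀ b ∈ B₂, a + b ∈ U) {L : ℝ} (hUL : (#U : ℝ) ≤ L * #B₁)
    (κ : ZMod p → ℝ) (hκ1 : ∀ x, κ x ≤ 1)
    (hκ : ∀ x, ∀ γ : AddChar (ZMod p) ℂ, ‖𝔼 b ∈ B₂, (f (x + w k₁ i • b) : ℂ) * γ b‖ ≤ κ x)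
    (y : Fin t → ZMod p) :
    (𝔼 a ∈ B₁, 𝔼 b ∈ B₂, f (y i + w k₁ i • a + w k₂ i • b) *
      ∏ j ∈ univ.erase i, g j (y j + w k₁ j • a + w k₂ j • b)) ^ 4 ≤
      L * 𝔼 a ∈ B₁, κ (y i + w k₁ i • a) := by
  set h := w k₁ i with hh
  have h1 : (0 : ℝ) < #B₁ := by exact_mod_cast hB₁.card_pos
  have h2 : (0 : ℝ) < #B₂ := by exact_mod_cast hB₂.card_pos
  have hκ0 : ∀ x, 0 ≤ κ x := fun x => (norm_nonneg _).trans (hκ x 0)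
  have hprod : ∀ (s : Finset (Fin t)) (F : Fin t → ℝ), (∀ j, |F j| ≤ 1) → |∏ j ∈ s, F j| ≤ 1 := by
    intro s F hF
    rw [abs_prod]
    exact prod_le_one (fun _ _ => abs_nonneg _) fun j _ => hF j
  have main := abs_sum_pow_four_le B₁ B₂ U hU (fun x => f (y i + h • x))
    (fun b => ∏ j ∈ (univ.erase i).filter (fun j => w k₁ j = 0), g j (y j + w k₂ j • b))
    (fun a => ∏ j ∈ (univ.erase i).filter (fun j => ¬ w k₁ j = 0), g j (y j + w k₁ j • a))
    (fun x => hf _) (fun b => hprod _ _ fun j => hg _ _) (fun a => hprod _ _ fun j => hg _ _)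
    (fun a => #B₂ * κ (y i + h • a)) (fun a _ γ => by
      have := hκ (y i + h • a) γ
      rw [expect_eq_sum_div_card, norm_div, Complex.norm_natCast, div_le_iff₀ h2] at this
      simpa [add_assoc, smul_add, mul_comm] using this)
  have hD : 𝔼 a ∈ B₁, 𝔼 b ∈ B₂, f (y i + h • a + w k₂ i • b) *
      ∏ j ∈ univ.erase i, g j (y j + w k₁ j • a + w k₂ j • b) =
      (∑ a ∈ B₁, ∑ b ∈ B₂, f (y i + h • (a + b)) *
      (∏ j ∈ (univ.erase i).filter (fun j => w k₁ j = 0), g j (y j + w k₂ j • b)) *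
      (∏ j ∈ (univ.erase i).filter (fun j => ¬ w k₁ j = 0), g j (y j + w k₁ j • a))) /
      (#B₁ * #B₂) := by
    simp only [expect_eq_sum_div_card]
    rw [← sum_div, div_div, mul_comm (#B₂ : ℝ)]
    congr 1
    refine sum_congr rfl fun a _ => sum_congr rfl fun b _ => ?_
    rw [← hk, smul_add, ← add_assoc, mul_assoc, ← prod_filter_mul_prod_filter_not (univ.erase i)
      (fun j => w k₁ j = 0)]
    congr 2
    · refine prod_congr rfl fun j hj => ?_
      rw [(mem_filter.1 hj).2]; simp
    · refine prod_congr rfl fun j hj => ?_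
      obtain ⟨hj1, hj2⟩ := mem_filter.1 hj
      rw [(hsplit j (mem_erase.1 hj1).1).resolve_left hj2]; simp
  rw [hD, div_pow, div_le_iff₀ (by positivity)]
  refine main.trans ?_
  have h3 : ∑ a ∈ B₁, (#B₂ * κ (y i + h • a)) ^ 2 ≤ (#B₂ : ℝ) ^ 2 * ∑ a ∈ B₁, κ (y i + h • a) := by
    rw [mul_sum]
    refine sum_le_sum fun a _ => ?_
    rw [mul_pow]
    gcongr
    rw [sq]
    exact mul_le_of_le_one_left (hκ0 _) (hκ1 _)
  have h4 : 0 ≤ ∑ a ∈ B₁, κ (y i + h • a) := sum_nonneg fun a _ => hκ0 _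
  have h5 : 0 ≤ L * #B₁ := (Nat.cast_nonneg _).trans hUL
  calc (#B₁ : ℝ) ^ 2 * (#B₂ : ℝ) ^ 2 * (#U * ∑ a ∈ B₁, (#B₂ * κ (y i + h • a)) ^ 2)
      ≤ (#B₁ : ℝ) ^ 2 * (#B₂ : ℝ) ^ 2 *
        ((L * #B₁) * ((#B₂ : ℝ) ^ 2 * ∑ a ∈ B₁, κ (y i + h • a))) := by gcongr
    _ = _ := by
      rw [expect_eq_sum_div_card]
      field_simp

lemma le_add_pow_four_div {x τ : ℝ} (hτ : 0 < τ) : |x| ≤ τ + x ^ 4 / τ ^ 3 := by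
  have hx : x ^ 4 = |x| ^ 4 := by rw [← abs_pow]; exact (abs_of_nonneg (by positivity)).symm
  rw [hx]
  have h0 := abs_nonneg x
  rcases le_total |x| τ with h | h
  · have : 0 ≤ |x| ^ 4 / τ ^ 3 := by positivity
    linarith
  · have h1 : |x| ≤ |x| ^ 4 / τ ^ 3 := by
      rw [le_div_iff₀ (by positivity), show |x| ^ 4 = |x| * |x| ^ 3 by ring]
      gcongr
    linarith

variable {p : ℕ} [Fact p.Prime] {ι : Type*} [Fintype ι] {t : ℕ}

/-- One term of the telescoping sum is small when there is no density increment. -/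
lemma abs_expect_term_le {w : ι → Fin t → ℤ} {i : Fin t} {k₁ k₂ : ι}
    (hk : w k₁ i = w k₂ i) (hsplit : ∀ j, j ≠ i → w k₁ j = 0 ∨ w k₂ j = 0)
    (f : ZMod p → ℝ) (hf : ∀ x, |f x| ≤ 1) (g : Fin t → ZMod p → ℝ) (hg : ∀ j x, |g j x| ≤ 1)
    {S B₁ B₂ U : Finset (ZMod p)} {P : Finset (ι → ZMod p)} (hS : S.Nonempty) (hP : P.Nonempty)
    (hB₁ : B₁.Nonempty) (hB₂ : B₂.Nonempty)
    (hU : ∀ a ∈ B₁, ∀ b ∈ B₂, a + b ∈ U) (hUL : (#U : ℝ) ≤ 2 * #B₁)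
    {ε ζ τ : ℝ} (hτ : 0 < τ) (hfS : 0 ≤ 𝔼 x ∈ S, f x)
    (hSinv : ∀ c ∈ P, ∀ a ∈ B₁, ∀ b ∈ B₂,
      AlmostInv S (∑ k, w k i • c k + w k₁ i • a + w k₁ i • b) ε)
    (hPinv : ∀ a ∈ B₁, ∀ b ∈ B₂, AlmostInv P (Pi.single k₁ a + Pi.single k₂ b) ε)
    (hloc : ∀ v, ∀ γ : AddChar (ZMod p) ℂ, ‖𝔼 b ∈ B₂, (f (v + w k₁ i • b) : ℂ) * γ b‖ +
      𝔼 b ∈ B₂, f (v + w k₁ i • b) ≤ 2 * ζ + 3 * ε) :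
    |𝔼 x ∈ S, 𝔼 c ∈ P, f (solCoord p w x c i) *
      ∏ j ∈ univ.erase i, g j (solCoord p w x c j)| ≤
      ε + τ + (4 * ζ + 8 * ε) / τ ^ 3 := by
  set h := w k₁ i with hh
  set κ : ZMod p → ℝ := fun v => ⨆ γ : AddChar (ZMod p) ℂ, ‖𝔼 b ∈ B₂, (f (v + h • b) : ℂ) * γ b‖
    with hκdef
  have hκ : ∀ v, ∀ γ : AddChar (ZMod p) ℂ, ‖𝔼 b ∈ B₂, (f (v + h • b) : ℂ) * γ b‖ ≤ κ v :=
    fun v γ => le_ciSup (f := fun γ : AddChar (ZMod p) ℂ =>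
      ‖𝔼 b ∈ B₂, (f (v + h • b) : ℂ) * γ b‖) (Set.finite_range _).bddAbove γ
  have hκ1 : ∀ v, κ v ≤ 1 := fun v => ciSup_le fun γ =>
    RCLike.norm_expect_le (K := ℂ) |>.trans (expect_le hB₂ fun b _ => by
      rw [norm_mul, AddChar.norm_apply, mul_one]; simpa using hf _)
  have hκ2 : ∀ v, κ v ≤ 2 * ζ + 3 * ε - 𝔼 b ∈ B₂, f (v + h • b) := fun v => ciSup_le fun γ => by
    have := hloc v γ
    linarith
  set Φ : ZMod p → (ι → ZMod p) → ℝ := fun x c =>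
    f (solCoord p w x c i) * ∏ j ∈ univ.erase i, g j (solCoord p w x c j) with hΦ
  have hΦ1 : ∀ x c, |Φ x c| ≤ 1 := by
    intro x c
    rw [hΦ, abs_mul, abs_prod]
    exact mul_le_one₀ (hf _) (prod_nonneg fun _ _ => abs_nonneg _)
      (prod_le_one (fun _ _ => abs_nonneg _) fun j _ => hg _ _)
  set D : ZMod p → (ι → ZMod p) → ℝ := fun x c => 𝔼 a ∈ B₁, 𝔼 b ∈ B₂,
    Φ x (c + (Pi.single k₁ a + Pi.single k₂ b)) with hD
  have hD4 : ∀ x c, D x c ^ 4 ≤ 2 * 𝔼 a ∈ B₁, κ (solCoord p w x c i + h • a) := by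
    intro x c
    have := expect_pow_four_le_of_split hk hsplit f hf g hg hB₁ hB₂ hU hUL κ hκ1 hκ
      (solCoord p w x c)
    simpa only [hD, hΦ, ← add_assoc, solCoord_add_single] using this
  have hΦD : ∀ x, |𝔼 c ∈ P, Φ x c - 𝔼 c ∈ P, D x c| ≤ ε := by
    intro x
    have e1 : 𝔼 c ∈ P, D x c = 𝔼 a ∈ B₁, 𝔼 b ∈ B₂, 𝔼 c ∈ P,
        Φ x (c + (Pi.single k₁ a + Pi.single k₂ b)) := by
      rw [hD, expect_comm]
      exact expect_congr rfl fun a _ => expect_comm _ _ _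
    have e2 : 𝔼 c ∈ P, Φ x c = 𝔼 a ∈ B₁, 𝔼 b ∈ B₂, 𝔼 c ∈ P, Φ x c := by
      rw [expect_const hB₂, expect_const hB₁]
    rw [e1, e2, ← expect_sub_distrib]
    refine (abs_expect_le _ _).trans (expect_le hB₁ fun a ha => ?_)
    rw [← expect_sub_distrib]
    refine (abs_expect_le _ _).trans (expect_le hB₂ fun b hb => ?_)
    rw [abs_sub_comm]
    exact (hPinv a ha b hb).real (Φ x) (hΦ1 x)
  have hmean : -ε ≤ 𝔼 x ∈ S, 𝔼 c ∈ P, 𝔼 a ∈ B₁, 𝔼 b ∈ B₂,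
      f (solCoord p w x c i + h • a + h • b) := by
    rw [expect_comm]
    refine le_expect hP fun c hc => ?_
    rw [expect_comm]
    refine le_expect hB₁ fun a ha => ?_
    rw [expect_comm]
    refine le_expect hB₂ fun b hb => ?_
    have := (abs_le.1 ((hSinv c hc a ha b hb).real f hf)).1
    simp only [solCoord, add_assoc] at this ⊢
    linarith
  have hκmean : 𝔼 x ∈ S, 𝔼 c ∈ P, 𝔼 a ∈ B₁, κ (solCoord p w x c i + h • a) ≤ 2 * ζ + 4 * ε := by
    have h1 : 𝔼 x ∈ S, 𝔼 c ∈ P, 𝔼 a ∈ B₁, κ (solCoord p w x c i + h • a) ≤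
        𝔼 x ∈ S, 𝔼 c ∈ P, 𝔼 a ∈ B₁, (2 * ζ + 3 * ε - 𝔼 b ∈ B₂,
          f (solCoord p w x c i + h • a + h • b)) :=
      expect_le_expect fun x _ => expect_le_expect fun c _ => expect_le_expect fun a _ => hκ2 _
    simp only [expect_sub_distrib, expect_const hB₁, expect_const hP, expect_const hS] at h1
    linarith
  have hDmean : 𝔼 x ∈ S, 𝔼 c ∈ P, |D x c| ≤ τ + (4 * ζ + 8 * ε) / τ ^ 3 := by
    have h1 : 𝔼 x ∈ S, 𝔼 c ∈ P, |D x c| ≤ 𝔼 x ∈ S, 𝔼 c ∈ P,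
        (τ + (2 * 𝔼 a ∈ B₁, κ (solCoord p w x c i + h • a)) / τ ^ 3) := by
      refine expect_le_expect fun x _ => expect_le_expect fun c _ => ?_
      refine (le_add_pow_four_div hτ).trans ?_
      gcongr
      exact hD4 x c
    simp only [expect_add_distrib, expect_const hP, expect_const hS, ← expect_div,
      ← mul_expect] at h1
    refine h1.trans ?_
    gcongr
    linarith
  have h1 : |𝔼 x ∈ S, 𝔼 c ∈ P, Φ x c| ≤ 𝔼 x ∈ S, (ε + 𝔼 c ∈ P, |D x c|) := by
    refine (abs_expect_le _ _).trans (expect_le_expect fun x _ => ?_)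
    have h2 := abs_expect_le P (D x)
    have h3 := abs_sub_abs_le_abs_sub (𝔼 c ∈ P, Φ x c) (𝔼 c ∈ P, D x c)
    have h4 := hΦD x
    linarith
  rw [expect_add_distrib, expect_const hS] at h1
  linarith

end VonNeumann

section Iteration

/-- A set that is almost invariant under a Bohr set of rank `d` and radius `ρ`, on which `A` has
density at least `δ`. -/
structure IsDenseOn {H : Type*} [AddCommGroup H] [Fintype H] (A : Finset H) (ε : ℝ) (n : H → ℝ)
    (d : ℕ) (ρ : ℝ) (S : Finset H) (δ : ℝ) : Prop where
  norm : IsBohrNorm n d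
  nonempty : S.Nonempty
  card_le : #(bohrBall n ρ) ≤ #S
  inv : ∀ s, n s ≤ ρ → AlmostInv S s ε
  density : δ ≤ 𝔼 x ∈ S, ind A x

lemma IsBohrNorm.pi_single_add_le {H ι : Type*} [AddCommGroup H] [Fintype ι] {n : H → ℝ} {d : ℕ}
    (hn : IsBohrNorm n d) (k l : ι) (a b : H) :
    ⨆ i, n ((Pi.single k a + Pi.single l b : ι → H) i) ≤ n a + n b := by
  have hsingle : ∀ (k i : ι) (a : H), n ((Pi.single k a : ι → H) i) ≤ n a := by
    intro k i a
    by_cases h : i = k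
    · subst h; simp
    · simp [h, hn.zero, hn.nonneg]
  refine Real.iSup_le (fun i => ?_) (add_nonneg (hn.nonneg _) (hn.nonneg _))
  exact (hn.add_le _ _).trans (add_le_add (hsingle _ _ _) (hsingle _ _ _))

lemma IsBohrNorm.exists_regular_almostInv {H : Type*} [AddCommGroup H] [Fintype H] {n : H → ℝ}
    {d : ℕ} (hn : IsBohrNorm n d) {E M : ℕ} (hE : 0 < E) (hM : 0 < M) (hdM : 14 * d * E ≤ M)
    {s : ℝ} (hs : 0 < s) : ∃ σ : ℝ, s ≤ σ ∧ σ ≤ 2 * s ∧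
      (#(bohrBall n (σ + s / M)) : ℝ) ≤ 2 * #(bohrBall n σ) ∧
      ∀ x, n x ≤ s / M → AlmostInv (bohrBall n σ) x (1 / E) := by
  obtain ⟨σ, h1, h2, h3⟩ := hn.exists_regular (E := 2 * E) (by omega) hM
    (le_trans (le_of_eq (by ring)) hdM) hs
  have hE' : (1 : ℝ) ≤ E := by exact_mod_cast hE
  refine ⟨σ, h1, h2, h3.trans ?_, fun x hx => hn.almostInv (hs.le.trans h1) ?_ hx⟩
  · gcongr
    push_cast
    have : 1 / (2 * (E : ℝ)) ≤ 1 := by rw [div_le_one (by positivity)]; linarith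
    linarith
  · convert h3 using 3
    push_cast
    field_simp

/-- The scale lost in one step of the iteration. -/
noncomputable def stepScale (m R M : ℕ) : ℝ := 1 / (64 * (m + 2) * R * M ^ 4)

variable {p : ℕ} [Fact p.Prime] {ι : Type*} [Fintype ι] {t : ℕ}

lemma norm_expect_mul_addChar_le_of_not_dense {A : Finset (ZMod p)} {E M d : ℕ} (hE : 0 < E)
    (hM : 14 * E * (d + 1) ≤ M) {n : ZMod p → ℝ} (hn : IsBohrNorm n d) {β ρ s : ℝ} (hs : 0 < s)
    (hβ0 : 0 ≤ β) (hβ1 : β ≤ 1) (hs1 : s ≤ 1) (hρ : ρ ≤ s / (2 * M ^ 2))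
    (hnot : ∀ n' S', ¬ IsDenseOn A (1 / E) n' (d + 1) ρ S' (β + 1 / E))
    {B : Finset (ZMod p)} (hB : B.Nonempty) (hBinv : ∀ x, n x ≤ s / M → AlmostInv B x (1 / E))
    {h : ℤ} (hh : (h : ZMod p) ≠ 0) (v : ZMod p) (γ : AddChar (ZMod p) ℂ) :
    ‖𝔼 b ∈ B, ((ind A (v + h • b) - β : ℝ) : ℂ) * γ b‖ + 𝔼 b ∈ B, (ind A (v + h • b) - β) ≤
      2 * (1 / E) + 3 * (1 / E) := by
  have hE1 : (1 : ℝ) ≤ E := by exact_mod_cast hE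
  have hEM : (E : ℝ) ≤ M := by
    have : E ≤ M := le_trans (by nlinarith) hM
    exact_mod_cast this
  have hM0 : (0 : ℝ) < M := by linarith
  have hM0' : 0 < M := by exact_mod_cast hM0
  set n' : ZMod p → ℝ := fun x => max (n x) ‖γ x - 1‖ with hn'
  have hn'B : IsBohrNorm n' (d + 1) := hn.max (isBohrNorm_addChar γ)
  obtain ⟨σ, h1, h2, -, h4⟩ := hn'B.exists_regular_almostInv hE hM0'
    (le_trans (le_of_eq (by ring)) hM) (s := s / (2 * M)) (by positivity)
  have hσ0 : 0 ≤ σ := le_trans (by positivity) h1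
  have hσ2 : σ ≤ s / M := h2.trans (le_of_eq (by field_simp))
  have hσE : σ ≤ 1 / E := hσ2.trans (div_le_div₀ (by norm_num) hs1 (by linarith) hEM)
  set e : ZMod p ≃+ ZMod p := AddAut.mulLeft (Units.mk0 (h : ZMod p) hh) with he
  have hec : ∀ c, e c = h • c := fun c => by simp [he, zsmul_eq_mul, Units.smul_def]
  refine norm_expect_mul_addChar_le (fun b => ind A (v + h • b) - β) (fun x => ?_) γ hB
    (hn'B.bohrBall_nonempty hσ0) (fun c hc => ?_) (fun c hc => ?_) (by positivity) fun b _ => ?_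
  · have := ind_nonneg A (v + h • x)
    have := ind_le_one A (v + h • x)
    exact abs_le.2 ⟨by linarith, by linarith⟩
  · exact hBinv c ((le_max_left _ _).trans ((mem_bohrBall.1 hc).trans hσ2))
  · exact (le_max_right _ _).trans ((mem_bohrBall.1 hc).trans hσE)
  · by_contra! hcon
    have hinj : Set.InjOn (fun c => (v + h • b) + e c) (bohrBall n' σ : Set (ZMod p)) :=
      fun x _ y _ hxy => by simpa using hxy
    have hρσ : ρ ≤ s / (2 * M) / M := hρ.trans (le_of_eq (by field_simp))
    refine hnot (fun x => n' (e.symm x)) ((bohrBall n' σ).image fun c => (v + h • b) + e c)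
      ⟨hn'B.comp_equiv e.symm, (hn'B.bohrBall_nonempty hσ0).image _, ?_, fun x hx => ?_, ?_⟩
    · rw [card_image_of_injOn hinj]
      refine card_le_card_of_injOn e.symm (fun x hx => ?_) e.symm.injective.injOn
      have hM1 : (1 : ℝ) ≤ M := hE1.trans hEM
      have hx' : n' (e.symm x) ≤ ρ := by simpa using hx
      have : s / (2 * M) / M ≤ s / (2 * M) := div_le_self (by positivity) hM1
      simpa using (by linarith : n' (e.symm x) ≤ σ)
    · have := (h4 (e.symm x) (hx.trans hρσ)).image e (v + h • b)
      simpa using this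
    · rw [expect_image hinj]
      simp only [expect_sub_distrib, expect_const (hn'B.bohrBall_nonempty hσ0)] at hcon
      simp only [hec, add_assoc, smul_add] at hcon ⊢
      linarith

/-- Either the number of solutions is as expected, or `A` has increased density on a smaller
almost invariant set. -/
lemma exists_count_or_increment {w : ι → Fin t → ℤ} {R : ℕ} (hR : 0 < R)
    (hwR : ∀ k j, |w k j| ≤ R)
    (hw : ∀ i, ∃ k₁ k₂, w k₁ i = w k₂ i ∧ (w k₁ i : ZMod p) ≠ 0 ∧
      ∀ j, j ≠ i → w k₁ j = 0 ∨ w k₂ j = 0)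
    {A : Finset (ZMod p)} {E M d : ℕ} (hE : 0 < E)
    (hM : 14 * E * (d + 1) * (Fintype.card ι + 1) ≤ M) {n : ZMod p → ℝ} {S : Finset (ZMod p)}
    {δ ρ τ : ℝ} (hρ0 : 0 < ρ) (hρ1 : ρ ≤ 1) (hτ : 0 < τ) (hδ : 0 ≤ δ)
    (hdense : IsDenseOn A (1 / E) n d ρ S δ) :
    (∃ σ, stepScale (Fintype.card ι) R M * ρ ≤ σ ∧
      δ ^ t - t * (1 / E + τ + (4 * (1 / E) + 8 * (1 / E)) / τ ^ 3) ≤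
        𝔼 x ∈ S, 𝔼 c ∈ bohrBall (fun x : ι → ZMod p => ⨆ k, n (x k)) σ,
          ∏ j, ind A (solCoord p w x c j)) ∨
    ∃ n' S', IsDenseOn A (1 / E) n' (d + 1) (stepScale (Fintype.card ι) R M * ρ) S'
      (δ + 1 / E) := by
  refine or_iff_not_imp_right.2 fun hnot => ?_
  push Not at hnot
  obtain ⟨hn, hS, -, hSinv, hβ⟩ := hdense
  set m := Fintype.card ι with hm
  have hE1 : (1 : ℝ) ≤ E := by exact_mod_cast hE
  have hR1 : (1 : ℝ) ≤ R := by exact_mod_cast hR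
  have hM1' : 1 ≤ M := le_trans (Nat.one_le_iff_ne_zero.2 (by positivity)) hM
  have hM1 : (1 : ℝ) ≤ M := by exact_mod_cast hM1'
  have hMd : 14 * E * (d + 1) ≤ M := le_trans (Nat.le_mul_of_pos_right _ (by omega)) hM
  set β := 𝔼 x ∈ S, ind A x with hβdef
  have hβ0 : 0 ≤ β := hδ.trans hβ
  have hβ1 : β ≤ 1 := expect_le hS fun x _ => ind_le_one _ _
  set s₀ : ℝ := ρ / (4 * (m + 2) * R) with hs₀
  set s₁ : ℝ := s₀ / (4 * M) with hs₁
  set s₂ : ℝ := s₁ / (2 * M) with hs₂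
  have hs₀0 : 0 < s₀ := by positivity
  have hs₁0 : 0 < s₁ := by positivity
  have hs₂0 : 0 < s₂ := by positivity
  have hs₀ρ : (2 * s₀) * ((m + 2) * R) ≤ ρ := by
    rw [hs₀]; field_simp; linarith
  have hs₁s₀ : 4 * s₁ = s₀ / M := by rw [hs₁]; field_simp
  have hs₂s₁ : 2 * s₂ = s₁ / M := by rw [hs₂]; field_simp
  have h10 : 4 * s₁ ≤ s₀ := hs₁s₀.trans_le (div_le_self hs₀0.le hM1)
  have h21 : 2 * s₂ ≤ s₁ := hs₂s₁.trans_le (div_le_self hs₁0.le hM1)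
  have hm0 : (0 : ℝ) ≤ m := Nat.cast_nonneg m
  have hs₀1 : s₀ ≤ 1 := by
    rw [hs₀, div_le_one (by positivity)]
    nlinarith [mul_nonneg hm0 (zero_le_one.trans hR1)]
  have hscale : stepScale m R M * ρ ≤ s₂ / (2 * M ^ 2) := by
    rw [hs₂, hs₁, hs₀, stepScale]
    apply le_of_eq
    field_simp
    norm_num
  obtain ⟨σ, hσ1, hσ2, -, hPinv⟩ := (hn.pi ι).exists_regular_almostInv hE hM1'
    (le_trans (by nlinarith [Nat.zero_le (E * m), Nat.zero_le (E * d)]) hM) hs₀0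
  obtain ⟨σ₁, hσ₁1, hσ₁2, hU, -⟩ := hn.exists_regular_almostInv hE hM1'
    (le_trans (by nlinarith) hMd) hs₁0
  obtain ⟨σ₂, hσ₂1, hσ₂2, -, hB₂inv⟩ := hn.exists_regular_almostInv hE hM1'
    (le_trans (by nlinarith) hMd) hs₂0
  have hPne := (hn.pi ι).bohrBall_nonempty (hs₀0.le.trans hσ1)
  refine ⟨σ, ?_, ?_⟩
  · refine hscale.trans (le_trans ?_ hσ1)
    have : s₂ / (2 * M ^ 2) ≤ s₂ := div_le_self hs₂0.le (by nlinarith)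
    linarith
  refine le_trans ?_ (pow_sub_le_expect_prod A hβ0 hβ1 hS hPne
    (δ := 1 / E + τ + (4 * (1 / E) + 8 * (1 / E)) / τ ^ 3) fun i g hg => ?_)
  · gcongr
  · obtain ⟨k₁, k₂, hk, hne, hsplit⟩ := hw i
    refine abs_expect_term_le hk hsplit (fun x => ind A x - β) (fun x => ?_) g hg hS hPne
      (hn.bohrBall_nonempty (hs₁0.le.trans hσ₁1)) (hn.bohrBall_nonempty (hs₂0.le.trans hσ₂1))
      (U := bohrBall n (σ₁ + s₁ / M)) (fun a ha b hb => ?_) hU hτ ?_ (fun c hc a ha b hb => ?_)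
      (fun a ha b hb => ?_) fun v γ => ?_
    · have := ind_nonneg A x
      have := ind_le_one A x
      exact abs_le.2 ⟨by linarith, by linarith⟩
    · rw [mem_bohrBall] at ha hb ⊢
      exact (hn.add_le a b).trans (add_le_add ha (hb.trans (hσ₂2.trans_eq hs₂s₁)))
    · rw [expect_sub_distrib, expect_const hS, sub_self]
    · rw [mem_bohrBall] at ha hb
      have hcn : ∀ k, n (c k) ≤ 2 * s₀ := fun k =>
        (le_ciSup (f := fun k => n (c k)) (Set.finite_range _).bddAbove k).trans
          ((mem_bohrBall.1 hc).trans hσ2)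
      have hz : ∀ (k : ι) (x : ZMod p), n x ≤ 2 * s₀ → n (w k i • x) ≤ R * (2 * s₀) := by
        intro k x hx
        refine (hn.zsmul_le _ _).trans (mul_le_mul ?_ hx (hn.nonneg _) (by positivity))
        exact_mod_cast hwR k i
      refine hSinv _ ?_
      have e1 := hn.add_le (∑ k, w k i • c k + w k₁ i • a) (w k₁ i • b)
      have e2 := hn.add_le (∑ k, w k i • c k) (w k₁ i • a)
      have e3 := hz k₁ a (by linarith only [ha, hσ₁2, h10, hs₀0])
      have e4 := hz k₁ b (by linarith only [hb, hσ₂2, h21, h10, hs₀0, hs₁0])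
      have e5 := (hn.sum_le univ fun k => w k i • c k).trans
        (sum_le_sum fun k _ => hz k (c k) (hcn k))
      rw [sum_const, card_univ, nsmul_eq_mul, ← hm] at e5
      have e6 : m * (R * (2 * s₀)) + R * (2 * s₀) + R * (2 * s₀) ≤ ρ :=
        (le_of_eq (by ring)).trans hs₀ρ
      linarith only [e1, e2, e3, e4, e5, e6]
    · rw [mem_bohrBall] at ha hb
      refine hPinv _ ((hn.pi_single_add_le k₁ k₂ a b).trans ?_)
      rw [← hs₁s₀]
      linarith only [ha, hb, hσ₁2, hσ₂2, h21, h10, hs₁0]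
    · exact norm_expect_mul_addChar_le_of_not_dense hE hMd hn hs₂0 hβ0 hβ1 (by linarith only [h21, h10, hs₀1, hs₁0, hs₂0]) hscale
        (fun n' S' h => hnot n' S' ⟨h.norm, h.nonempty, h.card_le, h.inv,
          le_trans (by linarith only [hβ]) h.density⟩)
        (hn.bohrBall_nonempty (hs₂0.le.trans hσ₂1)) hB₂inv hne v γ

end Iteration

section Count

lemma expect_prod_ind_mul_card_le {p : ℕ} [NeZero p] {ι : Type*} [Fintype ι] {t : ℕ}
    (w : ι → Fin t → ℤ) (A S : Finset (ZMod p)) (P : Finset (ι → ZMod p)) (hS : S.Nonempty)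
    (hP : P.Nonempty) :
    (𝔼 x ∈ S, 𝔼 c ∈ P, ∏ j, ind A (solCoord p w x c j)) * (#S * #P) ≤
      #{q : ZMod p × (ι → ZMod p) | ∀ j, solCoord p w q.1 q.2 j ∈ A} := by
  have hS' : (0 : ℝ) < #S := by exact_mod_cast hS.card_pos
  have hP' : (0 : ℝ) < #P := by exact_mod_cast hP.card_pos
  have hind : ∀ x c, ∏ j, ind A (solCoord p w x c j) =
      if ∀ j, solCoord p w x c j ∈ A then 1 else 0 := by
    intro x c
    split_ifs with h
    · exact prod_eq_one fun j _ => by simp [ind, h j]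
    · push Not at h
      obtain ⟨j, hj⟩ := h
      exact prod_eq_zero (mem_univ j) (by simp [ind, hj])
  have h1 : (𝔼 x ∈ S, 𝔼 c ∈ P, ∏ j, ind A (solCoord p w x c j)) * (#S * #P) =
      ∑ q ∈ S ×ˢ P, if ∀ j, solCoord p w q.1 q.2 j ∈ A then 1 else 0 := by
    rw [sum_product]
    simp only [expect_eq_sum_div_card, hind]
    rw [← sum_div]
    field_simp
  rw [h1, sum_boole]
  exact_mod_cast card_le_card fun q hq => by simpa using (mem_filter.1 hq).2

lemma IsBohrNorm.card_le_of_le {H : Type*} [AddCommGroup H] [Fintype H] {n : H → ℝ} {d e j : ℕ}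
    (hn : IsBohrNorm n d) (hde : d ≤ e) {ρ : ℝ} (hρ : 2 / 2 ^ j ≤ ρ) :
    (Fintype.card H : ℝ) ≤ 2 ^ (7 * e * j) * #(bohrBall n ρ) := by
  have h1 := hn.card_le j
  have h2 : 2 ^ (7 * d * j) * #(bohrBall n (2 / 2 ^ j)) ≤ 2 ^ (7 * e * j) * #(bohrBall n ρ) := by
    gcongr
    · norm_num
    · exact bohrBall_mono n hρ
  exact_mod_cast h1.trans h2

variable {p : ℕ} [Fact p.Prime] {ι : Type*} [Fintype ι] {t : ℕ}

lemma stepScale_pos {m R M : ℕ} (hR : 0 < R) (hM : 0 < M) : 0 < stepScale m R M := by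
  have : (0 : ℝ) < R := by exact_mod_cast hR
  have : (0 : ℝ) < M := by exact_mod_cast hM
  unfold stepScale
  positivity

lemma stepScale_le_one {m R M : ℕ} (hR : 0 < R) (hM : 0 < M) : stepScale m R M ≤ 1 := by
  have hR' : 1 ≤ R := hR
  have hM' : 1 ≤ M ^ 4 := Nat.one_le_pow _ _ hM
  have h : 1 ≤ 64 * (m + 2) * R * M ^ 4 := by
    calc 1 = 1 * 1 * 1 * 1 := rfl
      _ ≤ 64 * (m + 2) * R * M ^ 4 := by gcongr <;> omega
  unfold stepScale
  rw [div_le_one (by exact_mod_cast h)]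
  exact_mod_cast h

/-- The density increment iteration. -/
lemma exists_count {w : ι → Fin t → ℤ} {R : ℕ} (hR : 0 < R) (hwR : ∀ k j, |w k j| ≤ R)
    (hw : ∀ i, ∃ k₁ k₂, w k₁ i = w k₂ i ∧ (w k₁ i : ZMod p) ≠ 0 ∧
      ∀ j, j ≠ i → w k₁ j = 0 ∨ w k₂ j = 0)
    {A : Finset (ZMod p)} {E M : ℕ} (hE : 0 < E)
    (hM : 14 * E * (E + 1) * (Fintype.card ι + 1) ≤ M) {δ τ : ℝ} (hτ : 0 < τ) (hδ : 0 ≤ δ)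
    (hA : δ ≤ 𝔼 x, ind A x) :
    ∃ d ≤ E, ∃ n S σ, IsBohrNorm n d ∧ S.Nonempty ∧
      stepScale (Fintype.card ι) R M ^ (E + 1) ≤ σ ∧
      #(bohrBall n (stepScale (Fintype.card ι) R M ^ (E + 1))) ≤ #S ∧
      δ ^ t - t * (1 / E + τ + (4 * (1 / E) + 8 * (1 / E)) / τ ^ 3) ≤
        𝔼 x ∈ S, 𝔼 c ∈ bohrBall (fun x : ι → ZMod p => ⨆ k, n (x k)) σ,
          ∏ j, ind A (solCoord p w x c j) := by
  have hM0 : 0 < M := lt_of_lt_of_le (by positivity) hM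
  set θ := stepScale (Fintype.card ι) R M with hθ
  have hθ0 : 0 < θ := stepScale_pos hR hM0
  have hθ1 : θ ≤ 1 := stepScale_le_one hR hM0
  have hE' : (0 : ℝ) < E := by exact_mod_cast hE
  by_contra! hcon
  have hind : ∀ k ≤ E + 1, ∃ n S, IsDenseOn A (1 / E) n k (θ ^ k) S (δ + k / E) := by
    intro k
    induction k with
    | zero =>
      intro _
      refine ⟨fun _ => 0, univ, isBohrNorm_zero, univ_nonempty, card_le_univ _, fun s _ F _ => ?_,
        by simpa using hA⟩
      have : 𝔼 x, F (x + s) = 𝔼 x, F x :=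
        Fintype.expect_equiv (Equiv.addRight s) _ _ fun x => rfl
      rw [this, sub_self, norm_zero]
      positivity
    | succ k ih =>
      intro hk
      obtain ⟨n, S, hS⟩ := ih (by omega)
      have hδk : δ ≤ δ + k / E := le_add_of_nonneg_right (by positivity)
      rcases exists_count_or_increment hR hwR hw hE (le_trans (by gcongr) hM)
        (pow_pos hθ0 k) (pow_le_one₀ hθ0.le hθ1) hτ (hδ.trans hδk) hS with
        ⟨σ, hσ, hcount⟩ | ⟨n', S', h'⟩
      · have h1 : θ ^ (E + 1) ≤ θ ^ k := pow_le_pow_of_le_one hθ0.le hθ1 (by omega)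
        refine absurd (le_trans ?_ hcount) (not_le.2 (hcon k (by omega) n S σ hS.norm hS.nonempty
          ((?_ : θ ^ (E + 1) ≤ θ ^ (k + 1)).trans (by rwa [pow_succ']))
          ((card_le_card (bohrBall_mono n h1)).trans hS.card_le)))
        · gcongr
        · exact pow_le_pow_of_le_one hθ0.le hθ1 hk
      · refine ⟨n', S', ?_⟩
        rw [pow_succ', show δ + ((k + 1 : ℕ) : ℝ) / E = δ + k / E + 1 / E by push_cast; ring]
        exact h'
  obtain ⟨n, S, hS⟩ := hind (E + 1) le_rfl
  have h1 : 𝔼 x ∈ S, ind A x ≤ 1 := expect_le hS.nonempty fun x _ => ind_le_one A x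
  have h2 := hS.density
  have h3 : 1 < ((E + 1 : ℕ) : ℝ) / E := by
    rw [one_lt_div hE']; push_cast; linarith
  linarith

/-- A lower bound for the number of parameters of solutions in `A`. -/
lemma le_card_filter_solCoord {w : ι → Fin t → ℤ} {R : ℕ} (hR : 0 < R)
    (hwR : ∀ k j, |w k j| ≤ R)
    (hw : ∀ i, ∃ k₁ k₂, w k₁ i = w k₂ i ∧ (w k₁ i : ZMod p) ≠ 0 ∧
      ∀ j, j ≠ i → w k₁ j = 0 ∨ w k₂ j = 0)
    {A : Finset (ZMod p)} {E M J : ℕ} (hM : 14 * E * (E + 1) * (Fintype.card ι + 1) ≤ M)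
    (hJ : 64 * (Fintype.card ι + 2) * R * M ^ 4 ≤ 2 ^ J) {δ : ℝ} (hδ : 0 < δ) (hδ1 : δ ≤ 1)
    (hE : 12 * (8 * (t + 1)) ^ 4 ≤ E * δ ^ (4 * t)) (hA : δ ≤ 𝔼 x, ind A x) :
    δ ^ t / 2 * (p : ℝ) ^ (Fintype.card ι + 1) ≤
      2 ^ (7 * E * (J * (E + 1) + 1) * (Fintype.card ι + 1)) *
      #{q : ZMod p × (ι → ZMod p) | ∀ j, solCoord p w q.1 q.2 j ∈ A} := by
  set m := Fintype.card ι with hm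
  set j := J * (E + 1) + 1 with hj
  have hδt : 0 < δ ^ t := by positivity
  have hδt1 : δ ^ t ≤ 1 := pow_le_one₀ hδ.le hδ1
  set τ := δ ^ t / (8 * (t + 1)) with hτ
  have hτ0 : 0 < τ := by positivity
  have hτ1 : τ ≤ 1 := by
    rw [hτ, div_le_one (by positivity)]
    have : (0 : ℝ) ≤ t := Nat.cast_nonneg t
    linarith
  have hEτ : 12 ≤ E * τ ^ 4 := by
    rw [hτ, div_pow, ← pow_mul, mul_comm t 4, ← mul_div_assoc, le_div_iff₀ (by positivity)]
    exact hE
  have hE0 : 0 < E := by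
    rcases Nat.eq_zero_or_pos E with h | h
    · rw [h] at hEτ; norm_num at hEτ
    · exact h
  have hE0' : (0 : ℝ) < E := by exact_mod_cast hE0
  have hM0 : 0 < M := lt_of_lt_of_le (by positivity) hM
  have hθ0 := stepScale_pos (m := m) hR hM0
  obtain ⟨d, hd, n, S, σ, hn, hS, hσ, hcS, hcount⟩ := exists_count hR hwR hw hE0 hM hτ0 hδ.le hA
  rw [← hm] at hσ hcS
  have hscale : (2 : ℝ) / 2 ^ j ≤ stepScale m R M ^ (E + 1) := by
    have h1 : (2 : ℝ) / 2 ^ j = (1 / 2 ^ J) ^ (E + 1) := by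
      rw [hj, pow_succ, div_pow, one_pow, ← pow_mul]
      field_simp
    rw [h1, stepScale]
    have hJ' : 64 * ((m : ℝ) + 2) * R * M ^ 4 ≤ 2 ^ J := by exact_mod_cast hJ
    have : (0 : ℝ) < R := by exact_mod_cast hR
    have : (0 : ℝ) < M := by exact_mod_cast hM0
    gcongr
  have hlow : δ ^ t / 2 ≤ δ ^ t - t * (1 / E + τ + (4 * (1 / E) + 8 * (1 / E)) / τ ^ 3) := by
    have h1 : (4 * (1 / E) + 8 * (1 / E)) / τ ^ 3 ≤ τ := by
      rw [div_le_iff₀ (by positivity), ← pow_succ', show 4 * (1 / (E : ℝ)) + 8 * (1 / E) = 12 / E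
        by ring, div_le_iff₀ hE0', mul_comm]
      exact hEτ
    have h2 : 1 / (E : ℝ) ≤ τ := by
      rw [div_le_iff₀ hE0']
      have h4 : τ ^ 4 ≤ τ := pow_le_of_le_one hτ0.le hτ1 (by norm_num)
      nlinarith
    have h3 : t * (1 / E + τ + (4 * (1 / E) + 8 * (1 / E)) / τ ^ 3) ≤ (t + 1) * (3 * τ) := by
      gcongr <;> linarith
    have h4 : ((t : ℝ) + 1) * (3 * τ) = 3 / 8 * δ ^ t := by
      rw [hτ]; field_simp
    linarith
  have hP0 := (hn.pi ι).bohrBall_nonempty ((pow_pos hθ0 (E + 1)).le.trans hσ)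
  have hPcard := (hn.pi ι).card_le_of_le (e := E * m) (j := j) (by rw [hm]; gcongr)
    (hscale.trans hσ)
  have hScard : (p : ℝ) ≤ 2 ^ (7 * E * j) * #S := by
    have h1 := hn.card_le_of_le hd hscale
    rw [ZMod.card] at h1
    refine h1.trans ?_
    gcongr
  rw [Fintype.card_fun, ZMod.card, ← hm, Nat.cast_pow] at hPcard
  set P := bohrBall (fun x : ι → ZMod p => ⨆ k, n (x k)) σ with hP
  have hfin := expect_prod_ind_mul_card_le w A S P hS hP0
  calc δ ^ t / 2 * (p : ℝ) ^ (m + 1) = δ ^ t / 2 * (p * (p : ℝ) ^ m) := by rw [pow_succ']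
    _ ≤ (𝔼 x ∈ S, 𝔼 c ∈ P, ∏ j, ind A (solCoord p w x c j)) *
        ((2 ^ (7 * E * j) * #S) * (2 ^ (7 * (E * m) * j) * #P)) := by
        have := hlow.trans hcount
        have := hδt.le.trans (by linarith : δ ^ t ≤
          2 * 𝔼 x ∈ S, 𝔼 c ∈ P, ∏ j, ind A (solCoord p w x c j))
        gcongr
        linarith
    _ = 2 ^ (7 * E * j * (m + 1)) * ((𝔼 x ∈ S, 𝔼 c ∈ P, ∏ j, ind A (solCoord p w x c j)) *
        (#S * #P)) := by
        rw [show 7 * E * j * (m + 1) = 7 * E * j + 7 * (E * m) * j by ring, pow_add]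
        ring
    _ ≤ _ := by gcongr

end Count

section Kernel

variable {r t : ℕ} {V : Matrix (Fin r) (Fin t) ℤ}

/-- Clearing the denominators of a rational kernel vector. -/
lemma exists_int_multiple_mem_ker {x : Fin t → ℚ} (hx : ∀ k, ∑ j, (V k j : ℚ) * x j = 0) :
    ∃ b : ℤ, b ≠ 0 ∧ ∃ u : Fin t → ℤ, V.mulVec u = 0 ∧ ∀ j, (u j : ℚ) = b * x j := by
  obtain ⟨b, hb⟩ := IsLocalization.exist_integer_multiples_of_finite (nonZeroDivisors ℤ) x
  choose u hu using hb
  have hu' : ∀ j, (u j : ℚ) = (b : ℤ) * x j := fun j => by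
    have := hu j
    rw [zsmul_eq_mul] at this
    exact_mod_cast this
  refine ⟨b, nonZeroDivisors.coe_ne_zero b, u, ?_, hu'⟩
  ext k
  have : ((∑ j, V k j * u j : ℤ) : ℚ) = 0 := by
    push_cast
    simp only [hu']
    rw [← mul_zero ((b : ℤ) : ℚ), ← hx k, mul_sum]
    exact sum_congr rfl fun j _ => by ring
  simpa [Matrix.mulVec, dotProduct] using (by exact_mod_cast this : ∑ j, V k j * u j = 0)

/-- If `e_i` is not in the row space modulo `span {e_j : j ∈ X}`, then some kernel vector vanishes
on `X` but not at `i`. -/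
lemma exists_mem_ker_of_not_mem_rowSpanQ {i : Fin t} {X : Finset (Fin t)} (hi : i ∉ X)
    (h : ¬ ∃ y ∈ rowSpanQ r t V, y i = 1 ∧ ∀ j, j ≠ i → j ∉ X → y j = 0) :
    ∃ u : Fin t → ℤ, V.mulVec u = 0 ∧ u i ≠ 0 ∧ ∀ j ∈ X, u j = 0 := by
  set W : Submodule ℚ (Fin t → ℚ) :=
    rowSpanQ r t V ⊔ Submodule.span ℚ ((fun j => Pi.single j 1) '' (X : Set (Fin t))) with hW
  have hmem : (Pi.single i 1 : Fin t → ℚ) ∉ W := by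
    intro hmem
    obtain ⟨y, hy, z, hz, hyz⟩ := Submodule.mem_sup.1 hmem
    have hz0 : ∀ j, j ∉ X → z j = 0 := by
      intro j hj
      have : Submodule.span ℚ ((fun j => Pi.single j 1) '' (X : Set (Fin t))) ≤
          LinearMap.ker (LinearMap.proj j : (Fin t → ℚ) →ₗ[ℚ] ℚ) := by
        rw [Submodule.span_le]
        rintro _ ⟨l, hl, rfl⟩
        have : j ≠ l := fun h => hj (h ▸ hl)
        simp [this]
      exact this hz
    refine h ⟨y, hy, ?_, fun j hji hjX => ?_⟩
    · have := congrFun hyz i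
      simpa [hz0 i hi] using this
    · have := congrFun hyz j
      simpa [hz0 j hjX, hji] using this
  obtain ⟨φ, hφ, hφW⟩ := Submodule.exists_le_ker_of_notMem hmem
  have hφe : ∀ v : Fin t → ℚ, φ v = ∑ j, v j * φ (Pi.single j 1) := fun v => by
    conv_lhs => rw [← Finset.univ_sum_single v, map_sum]
    refine sum_congr rfl fun j _ => ?_
    rw [← smul_eq_mul, ← map_smul, ← Pi.single_smul, smul_eq_mul, mul_one]
  obtain ⟨b, hb, u, hu, hux⟩ := exists_int_multiple_mem_ker (V := V)
    (x := fun j => φ (Pi.single j 1)) (fun k => by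
      rw [← hφe fun j => (V k j : ℚ)]
      exact hφW (Submodule.mem_sup_left (Submodule.subset_span ⟨k, rfl⟩)))
  refine ⟨u, hu, fun h0 => ?_, fun j hj => ?_⟩
  · have := hux i
    rw [h0, Int.cast_zero, eq_comm, mul_eq_zero] at this
    exact this.elim (fun h => hb (by exact_mod_cast h)) hφ
  · have h0 : φ (Pi.single j 1) = 0 :=
      hφW (Submodule.mem_sup_right (Submodule.subset_span ⟨j, hj, rfl⟩))
    have := hux j
    rw [h0, mul_zero] at this
    exact_mod_cast this

lemma exists_split_ker (hV : MatrixComplexityOne r t V) (i : Fin t) :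
    ∃ u v : Fin t → ℤ, V.mulVec u = 0 ∧ V.mulVec v = 0 ∧ u i = v i ∧ u i ≠ 0 ∧
      ∀ j, j ≠ i → u j = 0 ∨ v j = 0 := by
  obtain ⟨X₁, X₂, -, -, -, hX, h1, h2⟩ := hV i
  have hi : i ∉ X₁ ∪ X₂ := by simp [hX]
  rw [mem_union, not_or] at hi
  obtain ⟨u, hu, hui, huX⟩ := exists_mem_ker_of_not_mem_rowSpanQ hi.1 h1
  obtain ⟨v, hv, hvi, hvX⟩ := exists_mem_ker_of_not_mem_rowSpanQ hi.2 h2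
  refine ⟨v i • u, u i • v, ?_, ?_, mul_comm _ _, mul_ne_zero hvi hui, fun j hj => ?_⟩
  · rw [Matrix.mulVec_smul, hu, smul_zero]
  · rw [Matrix.mulVec_smul, hv, smul_zero]
  · have hj' : j ∈ X₁ ∪ X₂ := by simp [hX, hj]
    rcases mem_union.1 hj' with h | h
    · exact Or.inl (by simp [huX j h])
    · exact Or.inr (by simp [hvX j h])

lemma exists_independent_ker (hrank : (V.map (fun z => (z : ℚ))).rank = r) :
    ∃ u : Fin (t - r) → Fin t → ℤ, (∀ k, V.mulVec (u k) = 0) ∧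
      ∀ a : Fin (t - r) → ℤ, (∀ j, ∑ k, a k * u k j = 0) → a = 0 := by
  set f := (V.map (fun z => (z : ℚ))).mulVecLin with hf
  have hker : Module.finrank ℚ (LinearMap.ker f) = t - r := by
    have h1 := f.finrank_range_add_finrank_ker
    rw [Matrix.rank] at hrank
    rw [hrank, Module.finrank_fin_fun] at h1
    omega
  let b := Module.finBasisOfFinrankEq ℚ (LinearMap.ker f) hker
  have hb : ∀ k l, ∑ j, (V l j : ℚ) * (b k : Fin t → ℚ) j = 0 := fun k l => by
    have h : (V.map (fun z => (z : ℚ))).mulVec (b k : Fin t → ℚ) = 0 := LinearMap.mem_ker.1 (b k).2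
    exact congrFun h l
  choose d hd u hu hud using fun k => exists_int_multiple_mem_ker (V := V) (hb k)
  refine ⟨u, hu, fun a ha => ?_⟩
  have hli := Fintype.linearIndependent_iff.1 b.linearIndependent (fun k => (a k : ℚ) * d k) (by
    ext j
    have : ((∑ k, a k * u k j : ℤ) : ℚ) = 0 := by rw [ha j, Int.cast_zero]
    push_cast at this
    simp only [hud] at this
    simpa [mul_assoc] using this)
  ext k
  have := (mul_eq_zero.1 (hli k)).resolve_right (by exact_mod_cast hd k)
  exact_mod_cast this

/-- A parametrization of the kernel of a system of complexity one. -/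
lemma exists_kernel_family (hrank : (V.map (fun z => (z : ℚ))).rank = r)
    (hV : MatrixComplexityOne r t V) :
    ∃ w : (Fin t ⊕ Fin t) ⊕ Fin (t - r) → Fin t → ℤ, (∀ k, V.mulVec (w k) = 0) ∧
      (∀ i, ∃ k₁ k₂, w k₁ i = w k₂ i ∧ w k₁ i ≠ 0 ∧ ∀ j, j ≠ i → w k₁ j = 0 ∨ w k₂ j = 0) ∧
      ∀ a : Fin (t - r) → ℤ, (∀ j, ∑ k, a k * w (.inr k) j = 0) → a = 0 := by
  choose u v hu hv huv hne hsplit using exists_split_ker hV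
  obtain ⟨z, hz, hzi⟩ := exists_independent_ker hrank
  refine ⟨Sum.elim (Sum.elim u v) z, ?_, fun i => ⟨.inl (.inl i), .inl (.inr i), huv i, hne i,
    hsplit i⟩, hzi⟩
  rintro ((k | k) | k)
  exacts [hu k, hv k, hz k]

end Kernel

section Transfer

/-- A homomorphism whose range has at least `L` elements has fibres of proportion at most
`1 / L`. -/
lemma card_mul_le_card_image_mul {G H : Type*} [AddCommGroup G] [AddCommGroup H] [Fintype G]
    (φ : G →+ H) (T : Finset G) {L : ℕ} (hL : L ≤ Nat.card φ.range) :
    #T * L ≤ #(T.image φ) * Fintype.card G := by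
  have h1 : #T ≤ #(T.image φ) * Nat.card φ.ker := by
    rw [mul_comm]
    refine card_le_mul_card_image T _ fun y _ => ?_
    rcases (T.filter fun x => φ x = y).eq_empty_or_nonempty with h | ⟨x₀, hx₀⟩
    · simp [h]
    rw [Nat.card_eq_fintype_card, Fintype.card_subtype]
    refine card_le_card_of_injOn (fun x => x - x₀) (fun x hx => ?_) fun x _ x' _ h => by
      simpa using h
    have e1 := (mem_filter.1 hx).2
    have e2 := (mem_filter.1 hx₀).2
    simp [AddMonoidHom.mem_ker, e1, e2]
  have h2 : Nat.card φ.ker * Nat.card φ.range = Fintype.card G := by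
    rw [← Nat.card_eq_fintype_card, ← AddSubgroup.card_mul_index φ.ker, AddSubgroup.index_ker]
  calc #T * L ≤ #(T.image φ) * Nat.card φ.ker * Nat.card φ.range := by gcongr
    _ = _ := by rw [mul_assoc, h2]

lemma eq_zero_of_abs_lt_of_cast_eq_zero {p : ℕ} {z : ℤ} (hz : |z| < p) (h : (z : ZMod p) = 0) :
    z = 0 :=
  Int.eq_zero_of_abs_lt_dvd ((ZMod.intCast_zmod_eq_zero_iff_dvd z p).1 h) hz

/-- The solutions with given parameters, as a homomorphism. -/
noncomputable def solHom (p : ℕ) {ι : Type*} [Fintype ι] {t : ℕ} (w : ι → Fin t → ℤ) :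
    ZMod p × (ι → ZMod p) →+ (Fin t → ZMod p) where
  toFun q := solCoord p w q.1 q.2
  map_zero' := by ext j; simp [solCoord]
  map_add' q q' := by
    ext j
    simp only [solCoord, Prod.fst_add, Prod.snd_add, Pi.add_apply, smul_add, sum_add_distrib]
    abel

lemma pow_le_card_range_solHom {p : ℕ} [NeZero p] {κ : Type*} [Fintype κ] {t s N R : ℕ}
    {w : κ ⊕ Fin s → Fin t → ℤ}
    (hwR : ∀ k j, |w k j| ≤ R) (hp : s * N * R < p)
    (hind : ∀ a : Fin s → ℤ, (∀ j, ∑ k, a k * w (.inr k) j = 0) → a = 0) :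
    N ^ s ≤ Nat.card (solHom p w).range := by
  have : N ^ s = Nat.card (Fin s → Fin N) := by simp
  rw [this]
  set g : (Fin s → Fin N) → (solHom p w).range := fun a =>
    ⟨solHom p w (0, Sum.elim 0 fun k => ((a k : ℕ) : ZMod p)), _, rfl⟩ with hg
  refine Nat.card_le_card_of_injective g fun a b hab => ?_
  have h0 : (fun k => ((a k : ℕ) : ℤ) - (b k : ℕ)) = 0 := by
    refine hind _ fun j => eq_zero_of_abs_lt_of_cast_eq_zero (p := p) ?_ ?_
    · refine lt_of_le_of_lt ((abs_sum_le_sum_abs _ _).trans (sum_le_card_nsmul _ _ (N * R : ℤ)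
        fun k _ => ?_)) (by rw [card_univ, Fintype.card_fin, nsmul_eq_mul, ← mul_assoc]
                            exact_mod_cast hp)
      rw [abs_mul]
      refine mul_le_mul ?_ (hwR _ _) (abs_nonneg _) (by positivity)
      have := (a k).2
      have := (b k).2
      rw [abs_le]
      omega
    · have := congrFun (congrArg Subtype.val hab) j
      simp only [hg, solHom, solCoord, AddMonoidHom.coe_mk, ZeroHom.coe_mk, zsmul_eq_mul,
        Fintype.sum_sum_type, Sum.elim_inl, Sum.elim_inr, Pi.zero_apply, mul_zero, sum_const_zero,
        zero_add] at this
      push_cast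
      rw [← sub_eq_zero, ← sum_sub_distrib] at this
      rw [← this]
      exact sum_congr rfl fun k _ => by ring
  ext k
  have := congrFun h0 k
  simp only [Pi.zero_apply, sub_eq_zero, Nat.cast_inj] at this
  exact this

/-- Solutions modulo a large prime lift to integer solutions. -/
lemma card_image_solHom_le {p : ℕ} [NeZero p] {ι : Type*} [Fintype ι] {r t N L : ℕ}
    {V : Matrix (Fin r) (Fin t) ℤ} (hTI : ∀ k : Fin r, ∑ j, V k j = 0)
    (hL : ∀ k, ∑ j, |V k j| ≤ L) (hp : L * N < p) {w : ι → Fin t → ℤ}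
    (hw : ∀ k, V.mulVec (w k) = 0) {A : Finset ℤ} (hA : (↑A : Set ℤ) ⊆ Set.Icc (-(N : ℤ)) (N : ℤ)) :
    #((univ.filter fun q : ZMod p × (ι → ZMod p) =>
      ∀ j, solCoord p w q.1 q.2 j ∈ A.image (Int.cast : ℤ → ZMod p)).image (solHom p w)) ≤
      {y : Fin t → ℤ | (∀ i, y i ∈ A) ∧ V.mulVec y = 0}.ncard := by
  have hfin : {y : Fin t → ℤ | (∀ i, y i ∈ A) ∧ V.mulVec y = 0}.Finite :=
    (Fintype.piFinset fun _ : Fin t => A).finite_toSet.subset fun y hy => by simpa using hy.1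
  rw [← Set.ncard_coe_finset]
  refine (Set.ncard_le_ncard (t := (fun y j => ((y j : ℤ) : ZMod p)) ''
    {y : Fin t → ℤ | (∀ i, y i ∈ A) ∧ V.mulVec y = 0}) ?_ (hfin.image _)).trans
    (Set.ncard_image_le hfin)
  intro z hz
  rw [mem_coe, mem_image] at hz
  obtain ⟨q, hq, rfl⟩ := hz
  have hq' := (mem_filter.1 hq).2
  simp only [mem_image] at hq'
  choose y hy hyq using hq'
  refine ⟨y, ⟨hy, ?_⟩, funext hyq⟩
  ext k
  simp only [Matrix.mulVec, dotProduct, Pi.zero_apply]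
  refine eq_zero_of_abs_lt_of_cast_eq_zero (p := p) ?_ ?_
  · calc |∑ j, V k j * y j| ≤ ∑ j, |V k j| * N := by
          refine (abs_sum_le_sum_abs _ _).trans (sum_le_sum fun j _ => ?_)
          rw [abs_mul]
          gcongr
          exact abs_le.2 (hA (hy j))
      _ ≤ L * N := by rw [← sum_mul]; gcongr; exact hL k
      _ < p := by exact_mod_cast hp
  · push_cast
    simp only [hyq, solCoord, mul_add, sum_add_distrib, ← sum_mul]
    have h1 : ∑ j, (V k j : ZMod p) = 0 := by
      rw [← Int.cast_sum, hTI k, Int.cast_zero]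
    rw [h1, zero_mul, zero_add]
    simp only [mul_sum, zsmul_eq_mul]
    rw [sum_comm]
    refine sum_eq_zero fun l _ => ?_
    have h2 : ∑ j, (V k j : ZMod p) * (w l j : ZMod p) = 0 := by
      have : ∑ j, V k j * w l j = 0 := congrFun (hw l) k
      rw [← Int.cast_zero, ← this]
      push_cast; rfl
    simp only [← mul_assoc, ← sum_mul, h2, zero_mul]

lemma expect_ind_image_cast {p : ℕ} [NeZero p] {N : ℕ} (hp : 2 * N < p) {A : Finset ℤ}
    (hA : (↑A : Set ℤ) ⊆ Set.Icc (-(N : ℤ)) (N : ℤ)) :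
    𝔼 x, ind (A.image (Int.cast : ℤ → ZMod p)) x = (#A : ℝ) / p := by
  rw [← card_image_of_injOn (f := (Int.cast : ℤ → ZMod p)) (s := A) fun a ha b hb hab => ?_]
  · simp [-mem_image, expect_eq_sum_div_card, ind, ZMod.card]
  · have ha' := hA ha
    have hb' := hA hb
    have : ((a - b : ℤ) : ZMod p) = 0 := by push_cast; rw [hab, sub_self]
    have := eq_zero_of_abs_lt_of_cast_eq_zero (abs_lt.2 ?_) this
    · omega
    · simp only [Set.mem_Icc] at ha' hb'
      omega

end Transfer

section Numerics

lemma exponent_le {m R E : ℕ} (hE : 1 ≤ E) :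
    7 * E * ((64 * (m + 2) * R + 4 * (14 * E * (E + 1) * (m + 1))) * (E + 1) + 1) * (m + 1) ≤
      7 * (m + 1) * (2 * (64 * (m + 2) * R + 112 * (m + 1)) + 1) * E ^ 4 := by
  have hE2 : E + 1 ≤ 2 * E := by omega
  have h1 : 64 * (m + 2) * R + 4 * (14 * E * (E + 1) * (m + 1)) ≤
      (64 * (m + 2) * R + 112 * (m + 1)) * E ^ 2 := by
    have : 1 ≤ E ^ 2 := Nat.one_le_pow _ _ hE
    calc 64 * (m + 2) * R + 4 * (14 * E * (E + 1) * (m + 1))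
        ≤ 64 * (m + 2) * R * E ^ 2 + 4 * (14 * E * (2 * E) * (m + 1)) :=
          add_le_add (Nat.le_mul_of_pos_right _ this) (by gcongr)
      _ = _ := by ring
  have h2 : 1 ≤ E ^ 3 := Nat.one_le_pow _ _ hE
  calc _ ≤ 7 * E * ((64 * (m + 2) * R + 112 * (m + 1)) * E ^ 2 * (2 * E) + E ^ 3) * (m + 1) := by
        gcongr
    _ = _ := by ring

lemma two_pow_bound {m R M : ℕ} : 64 * (m + 2) * R * M ^ 4 ≤ 2 ^ (64 * (m + 2) * R + 4 * M) := by
  rw [pow_add, mul_comm 4 M, pow_mul 2 M 4]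
  exact Nat.mul_le_mul Nat.lt_two_pow_self.le (Nat.pow_le_pow_left Nat.lt_two_pow_self.le 4)

/-- Choice of the parameters of the iteration. -/
lemma exists_parameters (t m R : ℕ) {K : ℝ} (hK : 1 ≤ K) :
    ∃ C : ℝ, 0 < C ∧ ∀ α : ℝ, 0 < α → α ≤ 1 → ∃ E M J : ℕ,
      14 * E * (E + 1) * (m + 1) ≤ M ∧ 64 * (m + 2) * R * M ^ 4 ≤ 2 ^ J ∧
      12 * (8 * ((t : ℝ) + 1)) ^ 4 ≤ E * (α / K) ^ (4 * t) ∧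
      Real.exp (-C * α ^ (-(24 * t : ℤ))) * 2 ^ (7 * E * (J * (E + 1) + 1) * (m + 1)) ≤
        (α / K) ^ t / 2 := by
  have hK0 : 0 < K := by linarith
  set D : ℝ := 12 * (8 * ((t : ℝ) + 1)) ^ 4 with hD
  have hD0 : 0 < D := by positivity
  set a : ℝ := D * K ^ (4 * t) + 1 with ha
  set c : ℕ := 7 * (m + 1) * (2 * (64 * (m + 2) * R + 112 * (m + 1)) + 1) with hc
  refine ⟨c * a ^ 4 + 2 * K ^ t, by positivity, fun α hα0 hα1 => ?_⟩
  set z : ℝ := (α ^ t)⁻¹ with hz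
  have hz1 : 1 ≤ z := (one_le_inv₀ (by positivity)).2 (pow_le_one₀ hα0.le hα1)
  have hz0 : 0 < z := by linarith
  have hα24 : α ^ (-(24 * t : ℤ)) = z ^ 24 := by
    rw [zpow_neg, show (24 * t : ℤ) = ((t * 24 : ℕ) : ℤ) by push_cast; ring, zpow_natCast, hz,
      pow_mul, inv_pow]
  have hδ : (α / K) ^ t = (K ^ t * z)⁻¹ := by
    rw [div_pow, hz]; field_simp
  have hδ4 : (α / K) ^ (4 * t) = (K ^ (4 * t) * z ^ 4)⁻¹ := by
    rw [mul_comm 4 t, pow_mul, hδ, inv_pow, mul_pow, pow_mul]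
  set E : ℕ := ⌈D * K ^ (4 * t) * z ^ 4⌉₊ with hE
  have hE1 : 1 ≤ E := Nat.one_le_iff_ne_zero.2 (Nat.ceil_pos.2 (by positivity)).ne'
  have hEa : (E : ℝ) ≤ a * z ^ 4 := by
    refine (Nat.ceil_lt_add_one (by positivity)).le.trans ?_
    have : (1 : ℝ) ≤ z ^ 4 := one_le_pow₀ hz1
    rw [ha, add_mul]
    linarith
  refine ⟨E, 14 * E * (E + 1) * (m + 1), 64 * (m + 2) * R + 4 * (14 * E * (E + 1) * (m + 1)),
    le_rfl, two_pow_bound, ?_, ?_⟩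
  · rw [hδ4, ← div_eq_mul_inv, le_div_iff₀ (by positivity), ← mul_assoc]
    exact Nat.le_ceil _
  · rw [hα24, hδ]
    set X := 7 * E * ((64 * (m + 2) * R + 4 * (14 * E * (E + 1) * (m + 1))) * (E + 1) + 1) *
      (m + 1) with hX
    have hX1 : (X : ℝ) ≤ c * a ^ 4 * z ^ 24 := by
      have h1 : (X : ℝ) ≤ c * (E : ℝ) ^ 4 := by exact_mod_cast exponent_le (m := m) (R := R) hE1
      calc (X : ℝ) ≤ c * (a * z ^ 4) ^ 4 := h1.trans (by gcongr)
        _ = c * a ^ 4 * z ^ 16 := by ring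
        _ ≤ c * a ^ 4 * z ^ 24 := by
            gcongr
            norm_num
    have h2 : (2 : ℝ) ^ X ≤ Real.exp (c * a ^ 4 * z ^ 24) := by
      have h3 : (2 : ℝ) ≤ Real.exp 1 := by
        have := Real.add_one_le_exp 1
        linarith
      calc (2 : ℝ) ^ X ≤ Real.exp 1 ^ X := by gcongr
        _ = Real.exp X := by rw [← Real.exp_nat_mul, mul_one]
        _ ≤ _ := Real.exp_le_exp.2 hX1
    have h4 : 2 * K ^ t * z ≤ Real.exp (2 * K ^ t * z ^ 24) := by
      have h5 : 2 * K ^ t * z ≤ 2 * K ^ t * z ^ 24 := by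
        gcongr
        exact le_self_pow₀ hz1 (by norm_num)
      have := Real.add_one_le_exp (2 * K ^ t * z ^ 24)
      linarith
    calc Real.exp (-(c * a ^ 4 + 2 * K ^ t) * z ^ 24) * 2 ^ X
        ≤ Real.exp (-(c * a ^ 4 + 2 * K ^ t) * z ^ 24) * Real.exp (c * a ^ 4 * z ^ 24) := by gcongr
      _ = (Real.exp (2 * K ^ t * z ^ 24))⁻¹ := by
          rw [← Real.exp_add, ← Real.exp_neg]
          ring_nf
      _ ≤ (2 * K ^ t * z)⁻¹ := by gcongr
      _ = (K ^ t * z)⁻¹ / 2 := by field_simp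

end Numerics

section Main

lemma exists_bound_natAbs {κ ι : Type*} [Fintype κ] [Fintype ι] (f : κ → ι → ℤ) :
    ∃ R : ℕ, 0 < R ∧ ∀ k, ∑ j, |f k j| ≤ R := by
  refine ⟨∑ k, ∑ j, (f k j).natAbs + 1, by omega, fun k => ?_⟩
  have h := single_le_sum (f := fun k => ∑ j, (f k j).natAbs) (fun _ _ => Nat.zero_le _)
    (mem_univ k)
  have h2 : ∑ j, |f k j| = ((∑ j, (f k j).natAbs : ℕ) : ℤ) := by push_cast; rfl
  rw [h2]
  exact_mod_cast h.trans (Nat.le_succ _)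

/-- The number of integer solutions in terms of the parameters of the iteration. -/
lemma mul_pow_le_ncard_solutions {r t : ℕ} {V : Matrix (Fin r) (Fin t) ℤ}
    (hTI : ∀ k : Fin r, ∑ j, V k j = 0) {κ : Type*} [Fintype κ] {s N R L p : ℕ}
    (hL : ∀ k, ∑ j, |V k j| ≤ L) {w : κ ⊕ Fin s → Fin t → ℤ} (hw : ∀ k, V.mulVec (w k) = 0)
    (hR : 0 < R) (hwR : ∀ k j, |w k j| ≤ R)
    (hsplit : ∀ i, ∃ k₁ k₂, w k₁ i = w k₂ i ∧ w k₁ i ≠ 0 ∧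
      ∀ j, j ≠ i → w k₁ j = 0 ∨ w k₂ j = 0)
    (hind : ∀ a : Fin s → ℤ, (∀ j, ∑ k, a k * w (.inr k) j = 0) → a = 0)
    (hp : p.Prime) (hp2 : 2 * N < p) (hpL : L * N < p) (hpR : R < p) (hps : s * N * R < p)
    {A : Finset ℤ} (hA : (↑A : Set ℤ) ⊆ Set.Icc (-(N : ℤ)) (N : ℤ)) {δ : ℝ} (hδ0 : 0 < δ)
    (hδ1 : δ ≤ 1) (hδ : δ ≤ #A / p) {E M J : ℕ}
    (hM : 14 * E * (E + 1) * (Fintype.card (κ ⊕ Fin s) + 1) ≤ M)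
    (hJ : 64 * (Fintype.card (κ ⊕ Fin s) + 2) * R * M ^ 4 ≤ 2 ^ J)
    (hE : 12 * (8 * ((t : ℝ) + 1)) ^ 4 ≤ E * δ ^ (4 * t)) :
    δ ^ t / 2 * (N : ℝ) ^ s ≤ 2 ^ (7 * E * (J * (E + 1) + 1) * (Fintype.card (κ ⊕ Fin s) + 1)) *
      ({y : Fin t → ℤ | (∀ i, y i ∈ A) ∧ V.mulVec y = 0}.ncard : ℝ) := by
  have : Fact p.Prime := ⟨hp⟩
  have hp0 : (0 : ℝ) < p := by exact_mod_cast hp.pos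
  set T := univ.filter fun q : ZMod p × (κ ⊕ Fin s → ZMod p) =>
    ∀ j, solCoord p w q.1 q.2 j ∈ A.image (Int.cast : ℤ → ZMod p)
  have h1 : δ ^ t / 2 * (p : ℝ) ^ (Fintype.card (κ ⊕ Fin s) + 1) ≤
      2 ^ (7 * E * (J * (E + 1) + 1) * (Fintype.card (κ ⊕ Fin s) + 1)) * #T := by
    convert le_card_filter_solCoord (p := p) (A := A.image (Int.cast : ℤ → ZMod p)) hR hwR
      (fun i => by
        obtain ⟨k₁, k₂, h, hne, hs⟩ := hsplit i
        refine ⟨k₁, k₂, h, fun h0 => hne (eq_zero_of_abs_lt_of_cast_eq_zero ?_ h0), hs⟩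
        exact (hwR k₁ i).trans_lt (by exact_mod_cast hpR)) hM hJ hδ0 hδ1 hE
      (by rwa [expect_ind_image_cast hp2 hA])
  have h2 := card_mul_le_card_image_mul (solHom p w) T (pow_le_card_range_solHom hwR hps hind)
  have h3 : #(T.image (solHom p w)) ≤
      {y : Fin t → ℤ | (∀ i, y i ∈ A) ∧ V.mulVec y = 0}.ncard := by
    convert card_image_solHom_le hTI hL hpL hw hA
  set X := 7 * E * (J * (E + 1) + 1) * (Fintype.card (κ ⊕ Fin s) + 1)
  set m := Fintype.card (κ ⊕ Fin s)
  set Q := {y : Fin t → ℤ | (∀ i, y i ∈ A) ∧ V.mulVec y = 0}.ncard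
  have h4 : (#T : ℝ) * (N : ℝ) ^ s ≤ Q * (p : ℝ) ^ (m + 1) := by
    have hcard : Fintype.card (ZMod p × (κ ⊕ Fin s → ZMod p)) = p ^ (m + 1) := by
      rw [Fintype.card_prod, Fintype.card_fun, ZMod.card, pow_succ']
    rw [hcard] at h2
    exact_mod_cast h2.trans (Nat.mul_le_mul_right _ (by convert h3))
  refine le_of_mul_le_mul_right ?_ (pow_pos hp0 (m + 1))
  calc δ ^ t / 2 * (N : ℝ) ^ s * (p : ℝ) ^ (m + 1)
      = δ ^ t / 2 * (p : ℝ) ^ (m + 1) * (N : ℝ) ^ s := by ring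
    _ ≤ 2 ^ X * #T * (N : ℝ) ^ s := by gcongr
    _ = 2 ^ X * (#T * (N : ℝ) ^ s) := by ring
    _ ≤ 2 ^ X * (Q * (p : ℝ) ^ (m + 1)) := by gcongr
    _ = 2 ^ X * Q * (p : ℝ) ^ (m + 1) := by ring

end Main

end ComplexityOne

/-- **Complexity-one systems in the integers.** For a translation-invariant matrix `V`
of rank `r` and complexity one, any `A ⊆ [-N, N]` of density `α` contains at least
`exp(-C α^{-24t}) N^{t-r}` solutions `y ∈ A^t` of `Vy = 0`. -/
theorem complexity_one_in_integers (r t : ℕ)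
    (V : Matrix (Fin r) (Fin t) ℤ)
    (hTI : ∀ k : Fin r, ∑ j, V k j = 0)
    (hrank : (V.map (fun z => (z : ℚ))).rank = r)
    (hcplx : MatrixComplexityOne r t V) :
    ∃ C : ℝ, 0 < C ∧ ∀ N : ℕ, 1 ≤ N →
      ∀ A : Finset ℤ, (↑A : Set ℤ) ⊆ Set.Icc (-(N : ℤ)) (N : ℤ) → A.Nonempty →
      ∀ α : ℝ, (A.card : ℝ) = α * (2 * N + 1) →
        Real.exp (-C * α ^ (-(24 * t : ℤ))) * (N : ℝ) ^ (t - r)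
          ≤ ({y : Fin t → ℤ | (∀ i, y i ∈ A) ∧ V.mulVec y = 0}.ncard : ℝ) := by
  obtain ⟨w, hw, hsplit, hind⟩ := exists_kernel_family hrank hcplx
  obtain ⟨L, -, hL⟩ := exists_bound_natAbs V
  obtain ⟨R, hR, hwR'⟩ := exists_bound_natAbs w
  have hwR : ∀ k j, |w k j| ≤ R := fun k j =>
    (Finset.single_le_sum (f := fun j => |w k j|) (fun _ _ => abs_nonneg _)
      (Finset.mem_univ j)).trans (hwR' k)
  set K : ℕ := 2 + L + (t - r) * R + R with hK
  obtain ⟨C, hC, hpar⟩ := exists_parameters t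
    (Fintype.card ((Fin t ⊕ Fin t) ⊕ Fin (t - r))) R (K := 2 * K) (by
      have : 1 ≤ 2 * K := by omega
      exact_mod_cast this)
  refine ⟨C, hC, fun N hN A hA hAne α hα => ?_⟩
  have hN0 : (1 : ℝ) ≤ N := by exact_mod_cast hN
  have hcard1 : (1 : ℝ) ≤ A.card := by exact_mod_cast hAne.card_pos
  have hcard2 : (A.card : ℝ) ≤ 2 * N + 1 := by
    have h1 : A ⊆ Finset.Icc (-(N : ℤ)) N := fun a ha => Finset.mem_Icc.2 (hA ha)
    have h2 := Finset.card_le_card h1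
    rw [Int.card_Icc] at h2
    have : A.card ≤ 2 * N + 1 := by omega
    exact_mod_cast this
  have hα0 : 0 < α := by
    by_contra! h
    nlinarith
  have hα1 : α ≤ 1 := by
    by_contra! h
    nlinarith
  obtain ⟨E, M, J, hM, hJ, hE, hfin⟩ := hpar α hα0 hα1
  have hK2 : 2 ≤ K := by omega
  obtain ⟨p, hp, hp1, hp2⟩ := Nat.exists_prime_lt_and_le_two_mul (K * N) (by positivity)
  have hlt : ∀ n, n ≤ K → n * N < p := fun n hn => (Nat.mul_le_mul_right N hn).trans_lt hp1
  have hpR := hlt R (by omega)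
  have hps := hlt ((t - r) * R) (by omega)
  have hKR : (2 : ℝ) ≤ K := by exact_mod_cast hK2
  have hδ1 : α / (2 * K) ≤ 1 := by
    rw [div_le_one (by positivity)]
    linarith
  have hδ : α / (2 * K) ≤ A.card / p := by
    have hpR : (p : ℝ) ≤ 2 * (K * N) := by exact_mod_cast hp2
    have hp0 : (0 : ℝ) < p := by exact_mod_cast hp.pos
    rw [hα, div_le_div_iff₀ (by positivity) hp0]
    calc α * p ≤ α * (2 * (K * N)) := by gcongr
      _ = α * N * (2 * K) := by ring
      _ ≤ α * (2 * N + 1) * (2 * K) := by gcongr; linarith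
  have key := mul_pow_le_ncard_solutions hTI hL hw hR hwR hsplit hind hp
    (hlt 2 (by omega)) (hlt L (by omega)) (lt_of_le_of_lt (Nat.le_mul_of_pos_right R hN) hpR)
    (lt_of_le_of_lt (le_of_eq (by ring)) hps) hA (by positivity) hδ1 hδ hM hJ hE
  set X := 7 * E * (J * (E + 1) + 1) * (Fintype.card ((Fin t ⊕ Fin t) ⊕ Fin (t - r)) + 1)
  refine le_of_mul_le_mul_left (le_trans ?_ key) (by positivity : (0 : ℝ) < 2 ^ X)
  calc 2 ^ X * (Real.exp (-C * α ^ (-(24 * t : ℤ))) * (N : ℝ) ^ (t - r))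
      = Real.exp (-C * α ^ (-(24 * t : ℤ))) * 2 ^ X * (N : ℝ) ^ (t - r) := by ring
    _ ≤ _ := by gcongr
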